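/- Let n ≥ 2 and fix signs ε_1,…,ε_n ∈ {1,−1}. There is a constant C > 0 such that for every F ∈ 𝒮(ℝ×ℝⁿ) and every j ∈ ℤ, ‖P_j ∫_0^t W_±(t−s)F(s)ds‖_{L^∞_t L²_x} ≤ C 2^{−j/2} sup_{e∈S^{n−1}} ‖P_j F‖_{L^{1,2}_e}. -/

import Mathlib

open MeasureTheory Complex Filter
open scoped FourierTransform RealInnerProductSpace ENNReal NNReal Topology

noncomputable section

namespace DNLS

/-- Euclidean space ℝⁿ. -/
abbrev Eucl (n : ℕ) := EuclideanSpace ℝ (Fin n)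

/-- The quadratic symbol `|ξ|²_± = Σ εᵢ ξᵢ²`. -/
def quadSym {n : ℕ} (ε : Fin n → ℝ) (ξ : Eucl n) : ℝ := ∑ i, ε i * (ξ i) ^ 2

/-- The signed vector `e_± = (ε₁e₁, …, εₙeₙ)`. -/
def epm {n : ℕ} (ε : Fin n → ℝ) (e : Eucl n) : Eucl n := WithLp.toLp 2 (fun i => ε i * e i)

/-- Fourier multiplier operator with symbol `m`. -/
def mulOp {n : ℕ} (m : Eucl n → ℂ) (f : Eucl n → ℂ) : Eucl n → ℂ :=
  𝓕⁻ (fun ξ => m ξ * 𝓕 f ξ)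

/-- The propagator `W_±(t)`, with `(W_±(t)φ)^(ξ) = e^{-it|ξ|²_±} φ̂(ξ)`. -/
def prop {n : ℕ} (ε : Fin n → ℝ) (t : ℝ) (φ : Eucl n → ℂ) : Eucl n → ℂ :=
  mulOp (fun ξ => Complex.exp (-Complex.I * t * quadSym ε ξ)) φ

/-- Fourier multiplier operator acting in the space variable of a space-time function. -/
def mulOpT {n : ℕ} (m : Eucl n → ℂ) (u : ℝ × Eucl n → ℂ) : ℝ × Eucl n → ℂ :=
  fun p => mulOp m (fun y => u (p.1, y)) p.2

/-- Hypotheses on the bump function χ : even, smooth, compactly supported in (-2,2),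
equal to one on [-1,1]. -/
structure IsBump (χ : ℝ → ℝ) : Prop where
  smooth : ∀ k : ℕ, ContDiff ℝ k χ
  even : ∀ s, χ (-s) = χ s
  supp : ∀ s, 2 ≤ |s| → χ s = 0
  one : ∀ s, |s| ≤ 1 → χ s = 1

/-- `ψ(s) = χ(|s|) - χ(2|s|)`. -/
def psiR (χ : ℝ → ℝ) (s : ℝ) : ℝ := χ |s| - χ (2 * |s|)

/-- `ψ_{≥k}(s) = Σ_{m ≥ k} ψ(2^{-m} s)`. -/
def psiGe (χ : ℝ → ℝ) (k : ℤ) (s : ℝ) : ℝ :=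
  ∑' m : ℤ, if k ≤ m then psiR χ ((2 : ℝ) ^ (-m) * s) else 0

/-- Littlewood–Paley projection `P_j`. -/
def proj {n : ℕ} (χ : ℝ → ℝ) (j : ℤ) (f : Eucl n → ℂ) : Eucl n → ℂ :=
  mulOp (fun ξ => (psiR χ ((2 : ℝ) ^ (-j) * ‖ξ‖) : ℂ)) f

/-- Low-frequency projection `P_{≤0} = I - Σ_{j≥1} P_j`. -/
def lowProj {n : ℕ} (χ : ℝ → ℝ) (f : Eucl n → ℂ) : Eucl n → ℂ :=
  mulOp (fun ξ => ((1 - psiGe χ 1 ‖ξ‖ : ℝ) : ℂ)) f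

/-- Directional frequency cutoff `Q^{e}_{j,l}` with symbol `ψ_{≥ j-l}(ξ·e)`. -/
def qproj {n : ℕ} (χ : ℝ → ℝ) (e : Eucl n) (j l : ℤ) (f : Eucl n → ℂ) : Eucl n → ℂ :=
  mulOp (fun ξ => ((psiGe χ (j - l) (inner ℝ ξ e : ℝ) : ℝ) : ℂ)) f

/-- `P_j` acting in the space variable of a space-time function. -/
def projT {n : ℕ} (χ : ℝ → ℝ) (j : ℤ) (u : ℝ × Eucl n → ℂ) : ℝ × Eucl n → ℂ :=
  fun p => proj χ j (fun y => u (p.1, y)) p.2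

/-- `P_{≤0}` acting in the space variable of a space-time function. -/
def lowProjT {n : ℕ} (χ : ℝ → ℝ) (u : ℝ × Eucl n → ℂ) : ℝ × Eucl n → ℂ :=
  fun p => lowProj χ (fun y => u (p.1, y)) p.2

/-- `Q^{e}_{j,l}` acting in the space variable of a space-time function. -/
def qprojT {n : ℕ} (χ : ℝ → ℝ) (e : Eucl n) (j l : ℤ) (u : ℝ × Eucl n → ℂ) :
    ℝ × Eucl n → ℂ :=
  fun p => qproj χ e j l (fun y => u (p.1, y)) p.2

/-- The hyperplane `P_e = {ξ : ξ·e = 0}`. -/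
def hyperplane {n : ℕ} (e : Eucl n) : Submodule ℝ (Eucl n) := (ℝ ∙ e)ᗮ

/-- Inner part of the anisotropic norm: the `L^q` norm over `P_e × ℝ` of
`(t,v) ↦ u(t, re + v)`. -/
def innerQ {n : ℕ} (q : ℝ≥0∞) (e : Eucl n) (u : ℝ × Eucl n → ℂ) (r : ℝ) : ℝ≥0∞ :=
  eLpNorm (fun tv : ℝ × (hyperplane e) => u (tv.1, r • e + (tv.2 : Eucl n))) q volume

/-- The anisotropic norm `‖u‖_{L^{p,q}_e}`. -/
def aniNorm {n : ℕ} (p q : ℝ≥0∞) (e : Eucl n) (u : ℝ × Eucl n → ℂ) : ℝ≥0∞ :=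
  if p = ∞ then essSup (innerQ q e u) volume
  else (∫⁻ r : ℝ, innerQ q e u r ^ p.toReal) ^ (1 / p.toReal)

/-- The mixed space-time norm `‖u‖_{L^q_t L^r_x}`. -/
def mixNorm {n : ℕ} (q r : ℝ≥0∞) (u : ℝ × Eucl n → ℂ) : ℝ≥0∞ :=
  if q = ∞ then essSup (fun t => eLpNorm (fun x => u (t, x)) r volume) volume
  else (∫⁻ t : ℝ, eLpNorm (fun x => u (t, x)) r volume ^ q.toReal) ^ (1 / q.toReal)

/-- `2^a` as an extended nonnegative real. -/
def tp (a : ℝ) : ℝ≥0∞ := ENNReal.ofReal ((2 : ℝ) ^ a)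

/-- Homogeneous Besov norm `‖φ‖_{Ḃ^s_{2,1}}`. -/
def homBesov {n : ℕ} (χ : ℝ → ℝ) (s : ℝ) (φ : Eucl n → ℂ) : ℝ≥0∞ :=
  ∑' j : ℤ, tp (s * j) * eLpNorm (proj χ j φ) 2 volume

/-- Inhomogeneous Besov norm `‖φ‖_{B^s_{2,1}}`. -/
def besov {n : ℕ} (χ : ℝ → ℝ) (s : ℝ) (φ : Eucl n → ℂ) : ℝ≥0∞ :=
  eLpNorm (lowProj χ φ) 2 volume
    + ∑' j : ℕ, tp (s * (j + 1)) * eLpNorm (proj χ (j + 1) φ) 2 volume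

/-- The supremum over unit vectors, auxiliary notation. -/
def sphSup {n : ℕ} (g : Eucl n → ℝ≥0∞) : ℝ≥0∞ := ⨆ (e : Eucl n) (_ : ‖e‖ = 1), g e

/-- `‖P_j u‖_{M^m_j} = 2^{-(n/2-1/(m-1))j} sup_e ‖P_j u‖_{L^{m-1,∞}_e}`. -/
def MmJ {n : ℕ} (χ : ℝ → ℝ) (m : ℕ) (j : ℤ) (u : ℝ × Eucl n → ℂ) : ℝ≥0∞ :=
  tp (-((n : ℝ) / 2 - 1 / ((m : ℝ) - 1)) * j)
    * sphSup (fun e => aniNorm ((m : ℝ≥0∞) - 1) ∞ e (projT χ j u))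

/-- `‖P_j u‖_{S_j} = 2^{j/2} sup_e ‖P_j Q^{e_±}_{j,20} u‖_{L^{∞,2}_e}`. -/
def SJ {n : ℕ} (ε : Fin n → ℝ) (χ : ℝ → ℝ) (j : ℤ) (u : ℝ × Eucl n → ℂ) : ℝ≥0∞ :=
  tp ((j : ℝ) / 2)
    * sphSup (fun e => aniNorm ∞ 2 e (projT χ j (qprojT χ (epm ε e) j 20 u)))

/-- `‖P_j u‖_{T_j} = ‖P_j u‖_{L^∞_t L²_x}`. -/
def TJ {n : ℕ} (χ : ℝ → ℝ) (j : ℤ) (u : ℝ × Eucl n → ℂ) : ℝ≥0∞ :=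
  mixNorm ∞ 2 (projT χ j u)

/-- `‖P_j u‖_{Y^m_j}`. -/
def YmJ {n : ℕ} (ε : Fin n → ℝ) (χ : ℝ → ℝ) (m : ℕ) (j : ℤ) (u : ℝ × Eucl n → ℂ) : ℝ≥0∞ :=
  MmJ χ m j u + SJ ε χ j u + TJ χ j u

/-- The homogeneous resolution norm `‖u‖_{Ż^σ_{2,1}}`. -/
def Zhom {n : ℕ} (ε : Fin n → ℝ) (χ : ℝ → ℝ) (m : ℕ) (σ : ℝ) (u : ℝ × Eucl n → ℂ) : ℝ≥0∞ :=
  ∑' j : ℤ, tp (σ * j) * YmJ ε χ m j u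

/-- `N_j`-norm of a function: `2^{-j/2} sup_e ‖f‖_{L^{1,2}_e}`. -/
def NJraw {n : ℕ} (j : ℤ) (f : ℝ × Eucl n → ℂ) : ℝ≥0∞ :=
  tp (-(j : ℝ) / 2) * sphSup (fun e => aniNorm 1 2 e f)

/-- `‖P_j u‖_{N_j}`. -/
def NJ {n : ℕ} (χ : ℝ → ℝ) (j : ℤ) (u : ℝ × Eucl n → ℂ) : ℝ≥0∞ :=
  NJraw j (projT χ j u)

/-- The homogeneous nonlinear norm `‖F‖_{Ṅ^σ_{2,1}}`. -/
def Nhom {n : ℕ} (χ : ℝ → ℝ) (σ : ℝ) (F : ℝ × Eucl n → ℂ) : ℝ≥0∞ :=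
  ∑' j : ℤ, tp (σ * j) * NJ χ j F

/-- `‖P_j u‖_{T̃_j} = ‖P_j u‖_{L^∞_t L²_x} + ‖P_j u‖_{L^{2+4/n}_{t,x}}`. -/
def TtilJ {n : ℕ} (χ : ℝ → ℝ) (j : ℤ) (u : ℝ × Eucl n → ℂ) : ℝ≥0∞ :=
  mixNorm ∞ 2 (projT χ j u)
    + eLpNorm (projT χ j u) (ENNReal.ofReal (2 + 4 / (n : ℝ))) volume

/-- `‖P_j u‖_{M̃_j} = sup_{p ∈ ℤ, p ≥ 2, np ≥ 6} sup_e 2^{(n/2-1/p)j}‖P_j u‖_{L^{p,∞}_e}`. -/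
def MtilJ {n : ℕ} (χ : ℝ → ℝ) (j : ℤ) (u : ℝ × Eucl n → ℂ) : ℝ≥0∞ :=
  ⨆ (p : ℕ) (_ : 2 ≤ p ∧ 6 ≤ n * p),
    sphSup (fun e => tp (((n : ℝ) / 2 - 1 / (p : ℝ)) * j) * aniNorm (p : ℝ≥0∞) ∞ e (projT χ j u))

/-- `‖P_j u‖_{Ỹ_j}`. -/
def YtilJ {n : ℕ} (ε : Fin n → ℝ) (χ : ℝ → ℝ) (j : ℤ) (u : ℝ × Eucl n → ℂ) : ℝ≥0∞ :=
  MtilJ χ j u + SJ ε χ j u + TtilJ χ j u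

/-- The inhomogeneous resolution norm `‖u‖_{Z̃^σ_{2,1}}`. -/
def Ztil {n : ℕ} (ε : Fin n → ℝ) (χ : ℝ → ℝ) (σ : ℝ) (u : ℝ × Eucl n → ℂ) : ℝ≥0∞ :=
  (∑' j : ℤ, if j ≤ 0 then YtilJ ε χ j u ^ 2 else 0) ^ ((1 : ℝ) / 2)
    + ∑' j : ℤ, if 1 ≤ j then tp (σ * j) * YtilJ ε χ j u else 0

/-- `‖f‖_{Ñ_j}`: infimum over decompositions `f = v + w`. -/
def NtilJraw {n : ℕ} (j : ℤ) (f : ℝ × Eucl n → ℂ) : ℝ≥0∞ :=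
  ⨅ (vw : (ℝ × Eucl n → ℂ) × (ℝ × Eucl n → ℂ)) (_ : f = vw.1 + vw.2),
    NJraw j vw.1 + eLpNorm vw.2 (ENNReal.ofReal ((2 * (n : ℝ) + 4) / ((n : ℝ) + 4))) volume

/-- The inhomogeneous nonlinear norm `‖F‖_{Ñ^σ_{2,1}}`. -/
def Ntil {n : ℕ} (χ : ℝ → ℝ) (σ : ℝ) (F : ℝ × Eucl n → ℂ) : ℝ≥0∞ :=
  (∑' j : ℤ, if j ≤ 0 then NtilJraw j (projT χ j F) ^ 2 else 0) ^ ((1 : ℝ) / 2)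
    + ∑' j : ℤ, if 1 ≤ j then tp (σ * j) * NtilJraw j (projT χ j F) else 0

/-- `k`-th spatial partial derivative of a space-time function. -/
def pd {n : ℕ} (k : ℕ) (u : ℝ × Eucl n → ℂ) (p : ℝ × Eucl n) : ℂ :=
  if h : k < n then fderiv ℝ (fun y => u (p.1, y)) p.2 (EuclideanSpace.single ⟨k, h⟩ (1 : ℝ))
  else 0

/-- The retarded Duhamel integral `∫_0^t W_±(t-s) G(s) ds`. -/
def duhamel {n : ℕ} (ε : Fin n → ℝ) (G : ℝ × Eucl n → ℂ) (p : ℝ × Eucl n) : ℂ :=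
  ∫ s in (0 : ℝ)..p.1, prop ε (p.1 - s) (fun y => G (s, y)) p.2

/-- Admissible Strichartz pair: `2/q = n(1/2 - 1/r)`, `q, r ≥ 2`, and `q ≠ 2` when `n = 2`. -/
def Admissible (n : ℕ) (q r : ℝ) : Prop :=
  2 / q = (n : ℝ) * (1 / 2 - 1 / r) ∧ 2 ≤ q ∧ 2 ≤ r ∧ (n = 2 → q ≠ 2)

/-- Value of a power series with coefficients `c` at `z`. -/
def polyVal {d : ℕ} (c : (Fin d →₀ ℕ) → ℂ) (z : Fin d → ℂ) : ℂ :=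
  ∑' β : Fin d →₀ ℕ, c β * ∏ i, z i ^ β i

/-- The argument vector `(u, ū, ∇u, ∇ū)` of the general nonlinearity. -/
def nlArg {n : ℕ} (u : ℝ × Eucl n → ℂ) (p : ℝ × Eucl n) (i : Fin (2 * n + 2)) : ℂ :=
  if (i : ℕ) = 0 then u p
  else if (i : ℕ) = 1 then starRingEnd ℂ (u p)
  else if (i : ℕ) < n + 2 then pd ((i : ℕ) - 2) u p
  else pd ((i : ℕ) - (n + 2)) (fun q => starRingEnd ℂ (u q)) p

/-- The argument vector `(∇u, ∇ū)` of a nonlinearity in `2n` variables. -/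
def gradArg {n : ℕ} (u : ℝ × Eucl n → ℂ) (p : ℝ × Eucl n) (i : Fin (2 * n)) : ℂ :=
  if (i : ℕ) < n then pd (i : ℕ) u p
  else pd ((i : ℕ) - n) (fun q => starRingEnd ℂ (u q)) p

end DNLS
open DNLS

/-- The Fourier integral of an integrable and square integrable function represents its
`L²` Fourier transform. -/
theorem fourier_ae_eq_fourier_toLp {V : Type*} [NormedAddCommGroup V] [InnerProductSpace ℝ V]
    [FiniteDimensional ℝ V] [MeasurableSpace V] [BorelSpace V] {h : V → ℂ}
    (h1 : Integrable h) (h2 : MemLp h 2) :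
    𝓕 h =ᵐ[volume] (𝓕 (h2.toLp h) : Lp ℂ 2 (volume : Measure V)) := by
  have hcont : Continuous (𝓕 h) :=
    VectorFourier.fourierIntegral_continuous Real.continuous_fourierChar
      (by exact continuous_inner) h1
  refine ae_eq_of_integral_contDiff_smul_eq (μ := volume) hcont.locallyIntegrable
    ((Lp.memLp _).locallyIntegrable (by norm_num)) ?_
  intro g hg hgc
  have hgc' : HasCompactSupport (fun x => (g x : ℂ)) := hgc.comp_left (g := ofReal) (by simp)
  have hg' : ContDiff ℝ (⊤ : ℕ∞) (fun x => (g x : ℂ)) := ofRealCLM.contDiff.comp hg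
  let G : SchwartzMap V ℂ := hgc'.toSchwartzMap hg'
  have e1 := congrArg (fun T => T G)
    (Lp.fourier_toTemperedDistribution_eq (h2.toLp h))
  simp only [TemperedDistribution.fourier_apply, Lp.toTemperedDistribution_apply] at e1
  have e2 := VectorFourier.integral_fourierIntegral_smul_eq_flip (μ := volume) (ν := volume)
    (L := innerₗ V) (f := (G : V → ℂ)) (g := h) Real.continuous_fourierChar
      (by exact continuous_inner) G.integrable h1
  rw [flip_innerₗ] at e2
  have e3 : ∫ x, (𝓕 G) x • (h2.toLp h) x = ∫ x, (𝓕 G) x • h x :=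
    integral_congr_ae (by filter_upwards [h2.coeFn_toLp] with x hx; rw [hx])
  rw [e3] at e1
  calc ∫ x, g x • 𝓕 h x = ∫ x, G x • 𝓕 h x := by rfl
    _ = ∫ x, (𝓕 G) x • h x := e2.symm
    _ = _ := e1

/-- Plancherel's theorem for integrable and square integrable functions. -/
theorem eLpNorm_fourier_eq {V : Type*} [NormedAddCommGroup V] [InnerProductSpace ℝ V]
    [FiniteDimensional ℝ V] [MeasurableSpace V] [BorelSpace V] {h : V → ℂ}
    (h1 : Integrable h) (h2 : MemLp h 2) :
    eLpNorm (𝓕 h) 2 volume = eLpNorm h 2 volume := by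
  rw [eLpNorm_congr_ae (fourier_ae_eq_fourier_toLp h1 h2), ← eLpNorm_congr_ae h2.coeFn_toLp,
    ← Lp.enorm_def, ← Lp.enorm_def, ← ofReal_norm, ← ofReal_norm, Lp.norm_fourier_eq]

/-- Plancherel's theorem for the inverse Fourier integral. -/
theorem eLpNorm_fourierInv_eq {V : Type*} [NormedAddCommGroup V] [InnerProductSpace ℝ V]
    [FiniteDimensional ℝ V] [MeasurableSpace V] [BorelSpace V] {h : V → ℂ}
    (h1 : Integrable h) (h2 : MemLp h 2) :
    eLpNorm (𝓕⁻ h) 2 volume = eLpNorm h 2 volume := by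
  have hcont : Continuous (𝓕 h) :=
    VectorFourier.fourierIntegral_continuous Real.continuous_fourierChar
      (by exact continuous_inner) h1
  have : 𝓕⁻ h = (𝓕 h) ∘ Neg.neg := by
    ext x; exact Real.fourierInv_eq_fourier_neg h x
  rw [this, eLpNorm_comp_measurePreserving hcont.aestronglyMeasurable
    (Measure.measurePreserving_neg volume), eLpNorm_fourier_eq h1 h2]

/-- Plancherel's theorem in terms of lower integrals. -/
theorem lintegral_enorm_sq_fourier {V : Type*} [NormedAddCommGroup V] [InnerProductSpace ℝ V]
    [FiniteDimensional ℝ V] [MeasurableSpace V] [BorelSpace V] {h : V → ℂ}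
    (h1 : Integrable h) (h2 : MemLp h 2) :
    ∫⁻ x, ‖𝓕 h x‖ₑ ^ 2 = ∫⁻ x, ‖h x‖ₑ ^ 2 := by
  have := congrArg (fun a => a ^ 2) (eLpNorm_fourier_eq h1 h2)
  have key : ∀ f : V → ℂ, (eLpNorm f 2 volume) ^ 2 = ∫⁻ x, ‖f x‖ₑ ^ 2 := fun f => by
    simpa using eLpNorm_nnreal_pow_eq_lintegral (f := f) (μ := volume) (p := 2) (by norm_num)
  simpa only [key] using this

/-- Parseval's identity in bilinear form. -/
theorem integral_mul_eq_integral_fourierInv_mul_fourier {V : Type*} [NormedAddCommGroup V]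
    [InnerProductSpace ℝ V] [FiniteDimensional ℝ V] [MeasurableSpace V] [BorelSpace V]
    {g h : V → ℂ} (g1 : Integrable g) (g2 : MemLp g 2) (h1 : Integrable h) (h2 : MemLp h 2) :
    ∫ ξ, g ξ * h ξ = ∫ x, 𝓕⁻ g x * 𝓕 h x := by
  have c1 : Integrable (fun x => starRingEnd ℂ (g x)) := by
    simpa using (LinearIsometryEquiv.integrable_comp_iff (conjLIE)).2 g1
  have c2 : MemLp (fun x => starRingEnd ℂ (g x)) 2 := by
    exact g2.star
  have key := Lp.inner_fourier_eq (c2.toLp _) (h2.toLp h)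
  rw [L2.inner_def, L2.inner_def] at key
  have hc : ∀ x, 𝓕 (fun x => starRingEnd ℂ (g x)) x = starRingEnd ℂ (𝓕⁻ g x) := by
    intro x
    rw [Real.fourier_eq', Real.fourierInv_eq', ← integral_conj]
    congr 1 with v
    simp [← Complex.exp_conj, map_ofNat]
  calc ∫ ξ, g ξ * h ξ = ∫ a, inner ℂ ((c2.toLp _) a) ((h2.toLp h) a) :=
        integral_congr_ae (by
          filter_upwards [c2.coeFn_toLp, h2.coeFn_toLp] with x hx hx'
          simp [hx, hx', mul_comm])
    _ = _ := key.symm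
    _ = _ := integral_congr_ae (by
          filter_upwards [fourier_ae_eq_fourier_toLp c1 c2, fourier_ae_eq_fourier_toLp h1 h2]
            with x hx hx'
          rw [← hx, ← hx', hc]
          simp [mul_comm])

/-- A bounded measurable function vanishing off a set of finite measure lies in every `L^p`. -/
theorem memLp_of_bounded_of_support {α : Type*} [MeasurableSpace α] {μ : Measure α}
    {f : α → ℂ} {B : ℝ} {s : Set α} (p : ℝ≥0∞) (hf : Measurable f) (hB : ∀ x, ‖f x‖ ≤ B)
    (hs : MeasurableSet s) (hμ : μ s < ∞) (hsupp : ∀ x, x ∉ s → f x = 0) : MemLp f p μ := by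
  have : s.indicator f = f := Set.indicator_eq_self.2 fun x hx => by
    by_contra h; exact hx (hsupp x h)
  rw [← this, memLp_indicator_iff_restrict hs]
  have : IsFiniteMeasure (μ.restrict s) := ⟨by simpa using hμ⟩
  exact MemLp.of_bound hf.aestronglyMeasurable B (ae_of_all _ hB)

/-- One-dimensional smoothing: oscillation `e^{iσsa²}` on `a ≥ c` gains `c^{-1/2}` in `L²_s`. -/
theorem lintegral_enorm_sq_quadratic_phase_le {f : ℝ → ℂ} {B c M σ : ℝ} (hc : 0 < c)
    (hσ : σ = 1 ∨ σ = -1) (hf : Measurable f) (hB : ∀ x, ‖f x‖ ≤ B)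
    (hlow : ∀ a, a < c → f a = 0) (hup : ∀ a, M < a → f a = 0) :
    ∫⁻ s : ℝ, ‖∫ a : ℝ, cexp (I * s * (σ * a ^ 2 : ℝ)) * f a‖ₑ ^ 2
      ≤ ENNReal.ofReal (Real.pi / c) * ∫⁻ a : ℝ, ‖f a‖ₑ ^ 2 := by
  have hB0 : 0 ≤ B := (norm_nonneg _).trans (hB 0)
  set m : ℝ → ℂ := fun b => f (√b) * ((2 * √b : ℝ) : ℂ)⁻¹ with hm
  have hmm : Measurable m := by
    have : Measurable fun b : ℝ => √b := Real.continuous_sqrt.measurable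
    exact (hf.comp this).mul (measurable_ofReal.comp (this.const_mul 2)).inv
  have hmB : ∀ b, ‖m b‖ ≤ B * (2 * c)⁻¹ := by
    intro b
    by_cases h : √b < c
    · simp only [hm, hlow _ h, zero_mul, norm_zero]; positivity
    · rw [hm, norm_mul, norm_inv, norm_real, Real.norm_of_nonneg (by positivity)]
      push Not at h
      gcongr
      exact hB _
  have hms : ∀ b, b ∉ Set.Icc (0 : ℝ) (M ^ 2) → m b = 0 := by
    intro b hb
    rw [hm]
    simp only
    by_cases h0 : 0 ≤ b
    · rw [hup, zero_mul]
      have : M ^ 2 < b := by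
        by_contra h; exact hb ⟨h0, not_lt.1 h⟩
      exact Real.lt_sqrt_of_sq_lt this
    · rw [Real.sqrt_eq_zero_of_nonpos (not_le.1 h0).le, hlow 0 hc, zero_mul]
  have hm0 : ∀ b, b ∉ Set.Ioi (0 : ℝ) → m b = 0 := by
    intro b hb
    simp only [hm, Real.sqrt_eq_zero_of_nonpos (not_lt.1 hb), hlow 0 hc, zero_mul]
  have hmp : ∀ p, MemLp m p := fun p =>
    memLp_of_bounded_of_support p hmm hmB measurableSet_Icc (by simp) hms
  have himg : (fun a : ℝ => a ^ 2) '' Set.Ioi 0 = Set.Ioi 0 := by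
    ext b
    constructor
    · rintro ⟨a, ha, rfl⟩; exact pow_pos (Set.mem_Ioi.1 ha) 2
    · intro hb; exact ⟨√b, Real.sqrt_pos.2 hb, Real.sq_sqrt (le_of_lt hb)⟩
  have hder : ∀ a ∈ Set.Ioi (0 : ℝ), HasDerivWithinAt (fun a : ℝ => a ^ 2) (2 * a) (Set.Ioi 0) a :=
    fun a _ => by simpa using (hasDerivAt_pow 2 a).hasDerivWithinAt
  have hinj : Set.InjOn (fun a : ℝ => a ^ 2) (Set.Ioi 0) := fun a ha b hb h =>
    (pow_left_inj₀ (le_of_lt ha) (le_of_lt hb) two_ne_zero).1 h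
  have hfour : ∀ s : ℝ, ∫ a : ℝ, cexp (I * s * (σ * a ^ 2 : ℝ)) * f a
      = 𝓕 m (-(σ * (2 * Real.pi)⁻¹) * s) := by
    intro s
    rw [Real.fourier_eq']
    calc ∫ a : ℝ, cexp (I * s * (σ * a ^ 2 : ℝ)) * f a
        = ∫ a in Set.Ioi (0 : ℝ), cexp (I * s * (σ * a ^ 2 : ℝ)) * f a := by
          refine (setIntegral_eq_integral_of_forall_compl_eq_zero fun a ha => ?_).symm
          rw [hlow a ((not_lt.1 ha).trans_lt hc), mul_zero]
      _ = ∫ a in Set.Ioi (0 : ℝ), |2 * a| • (cexp (I * s * (σ * a ^ 2 : ℝ)) * m (a ^ 2)) := by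
          refine setIntegral_congr_fun measurableSet_Ioi fun a ha => ?_
          have ha : 0 < a := ha
          have h2 : ((2 * a : ℝ) : ℂ) ≠ 0 := by exact_mod_cast (by positivity : (2 * a) ≠ 0)
          simp only [hm, Real.sqrt_sq ha.le]
          rw [abs_of_pos (by positivity), real_smul]
          field_simp
          rw [mul_comm a 2, mul_div_cancel_right₀ _ h2]
      _ = ∫ b in Set.Ioi (0 : ℝ), cexp (I * s * (σ * b : ℝ)) * m b := by
          rw [← integral_image_eq_integral_abs_deriv_smul measurableSet_Ioi hder hinj
            (fun b => cexp (I * s * (σ * b : ℝ)) * m b), himg]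
      _ = ∫ b, cexp (I * s * (σ * b : ℝ)) * m b := by
          refine setIntegral_eq_integral_of_forall_compl_eq_zero fun a ha => ?_
          rw [hm0 a ha, mul_zero]
      _ = _ := by
          congr 1 with b
          rw [smul_eq_mul]
          congr 2
          have : (Real.pi : ℂ) ≠ 0 := by exact_mod_cast Real.pi_ne_zero
          simp
          field_simp
  have hσ2 : |-(σ * (2 * Real.pi)⁻¹)|⁻¹ = 2 * Real.pi := by
    rw [abs_neg, abs_mul, abs_of_pos (by positivity : 0 < (2 * Real.pi)⁻¹)]
    rcases hσ with rfl | rfl <;> simp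
  have hne : -(σ * (2 * Real.pi)⁻¹) ≠ 0 := by
    have := Real.pi_pos
    rcases hσ with rfl | rfl <;> simp [this.ne']
  calc ∫⁻ s : ℝ, ‖∫ a : ℝ, cexp (I * s * (σ * a ^ 2 : ℝ)) * f a‖ₑ ^ 2
      = ∫⁻ s : ℝ, ‖𝓕 m (-(σ * (2 * Real.pi)⁻¹) * s)‖ₑ ^ 2 := by simp_rw [hfour]
    _ = ENNReal.ofReal (2 * Real.pi) * ∫⁻ s : ℝ, ‖𝓕 m s‖ₑ ^ 2 := by
        have hmeas : Measurable fun s => ‖𝓕 m s‖ₑ ^ 2 := by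
          have hcont : Continuous (𝓕 m) :=
            VectorFourier.fourierIntegral_continuous Real.continuous_fourierChar
              (by exact continuous_inner) (memLp_one_iff_integrable.1 (hmp 1))
          exact (hcont.measurable.enorm).pow_const 2
        rw [← lintegral_map hmeas (measurable_const_mul _),
          Real.map_volume_mul_left hne, lintegral_smul_measure, abs_inv, hσ2, smul_eq_mul]
    _ = ENNReal.ofReal (2 * Real.pi) * ∫⁻ b : ℝ, ‖m b‖ₑ ^ 2 := by
        rw [lintegral_enorm_sq_fourier (memLp_one_iff_integrable.1 (hmp 1)) (hmp 2)]
    _ = ENNReal.ofReal (2 * Real.pi) * ∫⁻ b in Set.Ioi (0 : ℝ), ‖m b‖ₑ ^ 2 := by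
        rw [setLIntegral_eq_of_support_subset]
        intro b hb
        by_contra h
        exact hb (by simp [hm0 b h])
    _ = ENNReal.ofReal (2 * Real.pi) *
          ∫⁻ a in Set.Ioi (0 : ℝ), ENNReal.ofReal |2 * a| * ‖m (a ^ 2)‖ₑ ^ 2 := by
        rw [← lintegral_image_eq_lintegral_abs_deriv_mul measurableSet_Ioi hder hinj
          (fun b => ‖m b‖ₑ ^ 2), himg]
    _ ≤ ENNReal.ofReal (2 * Real.pi) *
          ∫⁻ a in Set.Ioi (0 : ℝ), ENNReal.ofReal (2 * c)⁻¹ * ‖f a‖ₑ ^ 2 := by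
        gcongr ENNReal.ofReal (2 * Real.pi) * ?_
        refine setLIntegral_mono' measurableSet_Ioi fun a ha => ?_
        have ha : 0 < a := ha
        by_cases h : a < c
        · simp [hm, Real.sqrt_sq ha.le, hlow a h]
        · push Not at h
          simp only [hm, Real.sqrt_sq ha.le]
          rw [← ofReal_norm, ← ofReal_norm, ← ENNReal.ofReal_pow (norm_nonneg _),
            ← ENNReal.ofReal_pow (norm_nonneg _), ← ENNReal.ofReal_mul (by positivity),
            ← ENNReal.ofReal_mul (by positivity)]
          refine ENNReal.ofReal_le_ofReal ?_
          rw [norm_mul, norm_inv, norm_real, Real.norm_eq_abs, abs_of_pos (by positivity : 0 < 2 * a)]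
          have : 2 * a * (‖f a‖ * (2 * a)⁻¹) ^ 2 = (2 * a)⁻¹ * ‖f a‖ ^ 2 := by
            field_simp
          rw [this]
          gcongr
    _ ≤ ENNReal.ofReal (2 * Real.pi) * (ENNReal.ofReal (2 * c)⁻¹ * ∫⁻ a : ℝ, ‖f a‖ₑ ^ 2) := by
        rw [lintegral_const_mul _ (hf.enorm.pow_const 2)]
        gcongr
        exact Measure.restrict_le_self
    _ = _ := by
        rw [← mul_assoc, ← ENNReal.ofReal_mul (by positivity)]
        congr 2
        field_simp

/-- Orthogonal coordinates `(r, v) ↦ re + v` adapted to a unit vector `e`. -/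
def orthCoord {n : ℕ} (e : Eucl n) (he : ‖e‖ = 1) : ℝ × hyperplane e ≃ᵐ Eucl n :=
  (MeasurableEquiv.toLp 2 (ℝ × hyperplane e)).trans
    ((LinearIsometryEquiv.withLpProdCongr 2 (LinearIsometryEquiv.toSpanUnitSingleton e he)
      (LinearIsometryEquiv.refl ℝ (hyperplane e))).trans
        (Submodule.orthogonalDecomposition (ℝ ∙ e)).symm).toMeasurableEquiv

theorem orthCoord_apply {n : ℕ} (e : Eucl n) (he : ‖e‖ = 1) (p : ℝ × hyperplane e) :
    orthCoord e he p = p.1 • e + (p.2 : Eucl n) := by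
  change (Submodule.orthogonalDecomposition (ℝ ∙ e)).symm
    (WithLp.toLp 2 (LinearIsometryEquiv.toSpanUnitSingleton e he p.1, p.2)) = _
  simp

theorem measurePreserving_orthCoord {n : ℕ} (e : Eucl n) (he : ‖e‖ = 1) :
    MeasurePreserving (orthCoord e he) :=
  (WithLp.volume_preserving_symm_measurableEquiv_toLp_prod ℝ (hyperplane e)).symm.trans
    (LinearIsometryEquiv.measurePreserving _)

/-- Integration in orthogonal coordinates adapted to `e`. -/
theorem lintegral_eq_lintegral_orthCoord {n : ℕ} {e : Eucl n} (he : ‖e‖ = 1)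
    {g : Eucl n → ℝ≥0∞} (hg : Measurable g) :
    ∫⁻ ξ, g ξ = ∫⁻ η : hyperplane e, ∫⁻ a : ℝ, g (a • e + (η : Eucl n)) := by
  rw [← (measurePreserving_orthCoord e he).lintegral_comp hg, Measure.volume_eq_prod,
    lintegral_prod_symm (fun p => g (orthCoord e he p)) (hg.comp (orthCoord e he).measurable).aemeasurable]
  simp_rw [orthCoord_apply]

theorem inner_orthCoord {n : ℕ} {e : Eucl n} (he : ‖e‖ = 1) (a r : ℝ) (η v : hyperplane e) :
    ⟪a • e + (η : Eucl n), r • e + (v : Eucl n)⟫ = a * r + ⟪η, v⟫ := by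
  have h1 : ⟪e, (v : Eucl n)⟫ = 0 := Submodule.mem_orthogonal_singleton_iff_inner_right.1 v.2
  have h2 : ⟪(η : Eucl n), e⟫ = 0 := Submodule.mem_orthogonal_singleton_iff_inner_left.1 η.2
  simp [inner_add_left, inner_add_right, inner_smul_left, inner_smul_right, h1, h2, he,
    mul_comm]

theorem continuous_quadSym {n : ℕ} (ε : Fin n → ℝ) : Continuous (quadSym ε) := by
  unfold quadSym; fun_prop

/-- The Fourier integral of the propagated profile `e^{is|ξ|²_±} φ(ξ)`. -/
def evolve {n : ℕ} (ε : Fin n → ℝ) (φ : Eucl n → ℂ) (s : ℝ) (x : Eucl n) : ℂ :=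
  𝓕 (fun ξ => cexp (I * s * quadSym ε ξ) * φ ξ) x

theorem norm_exp_I_mul_ofReal_mul_ofReal (s a : ℝ) : ‖cexp (I * s * a)‖ = 1 := by
  rw [mul_assoc, ← ofReal_mul, mul_comm]; exact norm_exp_ofReal_mul_I _

theorem measurable_evolve {n : ℕ} (ε : Fin n → ℝ) {φ : Eucl n → ℂ} (hφ : Measurable φ) :
    Measurable fun p : ℝ × Eucl n => evolve ε φ p.1 p.2 := by
  have hq := (continuous_quadSym ε).measurable
  have : StronglyMeasurable fun z : (ℝ × Eucl n) × Eucl n =>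
      cexp (((-2 * Real.pi * ⟪z.2, z.1.2⟫ : ℝ) : ℂ) * I) •
        (cexp (I * z.1.1 * quadSym ε z.2) * φ z.2) := by
    have h1 : Measurable fun z : (ℝ × Eucl n) × Eucl n => ⟪z.2, z.1.2⟫ :=
      measurable_snd.inner (measurable_snd.comp measurable_fst)
    apply Measurable.stronglyMeasurable
    fun_prop
  have h := (this.integral_prod_right' (ν := (volume : Measure (Eucl n)))).measurable
  simpa only [evolve, Real.fourier_eq'] using h

/-- The Fourier integral of a propagated profile restricted to the hyperplane `re + P_e` is the
Fourier integral over `P_e` of the one-dimensional oscillatory integrals along `e`. -/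
theorem evolve_orthCoord {n : ℕ} {ε : Fin n → ℝ} {e : Eucl n} {σ : ℝ} (he : ‖e‖ = 1)
    (hq : ∀ (a : ℝ) (η : hyperplane e),
      quadSym ε (a • e + (η : Eucl n)) = σ * a ^ 2 + quadSym ε (η : Eucl n))
    {φ : Eucl n → ℂ} (hφ : Integrable φ) (s r : ℝ) (v : hyperplane e) :
    evolve ε φ s (r • e + (v : Eucl n)) = 𝓕 (fun η : hyperplane e =>
      cexp (I * s * quadSym ε (η : Eucl n)) * ∫ a : ℝ, cexp (I * s * (σ * a ^ 2 : ℝ)) *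
        (cexp (((-2 * Real.pi * (a * r) : ℝ) : ℂ) * I) * φ (a • e + (η : Eucl n)))) v := by
  rw [evolve, Real.fourier_eq', Real.fourier_eq']
  have hmp := measurePreserving_orthCoord e he
  have h_int : Integrable (fun ξ : Eucl n =>
      cexp (((-2 * Real.pi * ⟪ξ, r • e + (v : Eucl n)⟫ : ℝ) : ℂ) * I) •
        (cexp (I * s * quadSym ε ξ) * φ ξ)) := by
    have hqc := continuous_quadSym ε
    have h1 : Integrable (fun ξ : Eucl n => cexp (I * s * quadSym ε ξ) * φ ξ) :=
      hφ.bdd_mul (c := 1) (by fun_prop)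
        (ae_of_all _ fun ξ => (norm_exp_I_mul_ofReal_mul_ofReal _ _).le)
    exact h1.bdd_mul (c := 1) (by fun_prop)
      (ae_of_all _ fun ξ => (norm_exp_ofReal_mul_I _).le)
  rw [← hmp.integral_comp' (g := fun ξ : Eucl n =>
      cexp (((-2 * Real.pi * ⟪ξ, r • e + (v : Eucl n)⟫ : ℝ) : ℂ) * I) •
        (cexp (I * s * quadSym ε ξ) * φ ξ)), Measure.volume_eq_prod, integral_prod_symm]
  · congr 1 with η
    rw [smul_eq_mul, ← mul_assoc, ← integral_const_mul]
    congr 1 with a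
    rw [orthCoord_apply, hq, inner_orthCoord he, smul_eq_mul, ofReal_add (σ * a ^ 2),
      mul_add (I * s : ℂ),
      Complex.exp_add, mul_add (-2 * Real.pi), ofReal_add, add_mul, Complex.exp_add]
    ring
  · exact (hmp.integrable_comp_emb (orthCoord e he).measurableEmbedding).2 h_int

/-- The homogeneous local smoothing estimate in the direction `e`. -/
theorem local_smoothing {n : ℕ} {ε : Fin n → ℝ} {e : Eucl n} {σ : ℝ} (he : ‖e‖ = 1)
    (hσ : σ = 1 ∨ σ = -1)
    (hq : ∀ (a : ℝ) (η : hyperplane e),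
      quadSym ε (a • e + (η : Eucl n)) = σ * a ^ 2 + quadSym ε (η : Eucl n))
    {φ : Eucl n → ℂ} {B c M : ℝ} (hc : 0 < c) (hφ : Measurable φ) (hB : ∀ ξ, ‖φ ξ‖ ≤ B)
    (hlow : ∀ ξ, ⟪e, ξ⟫ < c → φ ξ = 0) (hup : ∀ ξ, M < ‖ξ‖ → φ ξ = 0) (r : ℝ) :
    ∫⁻ p : ℝ × hyperplane e, ‖evolve ε φ p.1 (r • e + (p.2 : Eucl n))‖ₑ ^ 2
      ≤ ENNReal.ofReal (Real.pi / c) * ∫⁻ ξ, ‖φ ξ‖ₑ ^ 2 := by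
  have hB0 : 0 ≤ B := (norm_nonneg _).trans (hB 0)
  have hqc := continuous_quadSym ε
  have hφp : ∀ p, MemLp φ p := fun p =>
    memLp_of_bounded_of_support (s := Metric.closedBall 0 M) p hφ hB measurableSet_closedBall
      measure_closedBall_lt_top fun ξ hξ => hup ξ (by simpa using hξ)
  have hφ1 := memLp_one_iff_integrable.1 (hφp 1)
  have hcoord : ∀ (a : ℝ) (η : hyperplane e), ⟪e, a • e + (η : Eucl n)⟫ = a := by
    intro a η
    have := inner_orthCoord he 1 a 0 η
    simpa using this
  have hnorm1 : ∀ (a : ℝ) (η : hyperplane e), |a| ≤ ‖a • e + (η : Eucl n)‖ := by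
    intro a η
    have := abs_real_inner_le_norm e (a • e + (η : Eucl n))
    rwa [hcoord, he, one_mul] at this
  have hnorm2 : ∀ (a : ℝ) (η : hyperplane e), ‖η‖ ≤ ‖a • e + (η : Eucl n)‖ := by
    intro a η
    refine abs_le_of_sq_le_sq' ?_ (norm_nonneg _) |>.2
    rw [← real_inner_self_eq_norm_sq, ← real_inner_self_eq_norm_sq, inner_orthCoord he]
    nlinarith [mul_self_nonneg a]
  obtain ⟨f, hf⟩ : ∃ f : hyperplane e → ℝ → ℂ, ∀ η a, f η a =
    cexp (((-2 * Real.pi * (a * r) : ℝ) : ℂ) * I) * φ (a • e + (η : Eucl n)) := ⟨_, fun _ _ => rfl⟩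
  have hfm : Measurable fun p : hyperplane e × ℝ => f p.1 p.2 := by
    have : Measurable fun p : hyperplane e × ℝ => φ (p.2 • e + (p.1 : Eucl n)) :=
      hφ.comp (Continuous.measurable (by fun_prop))
    have h2 : Measurable fun p : hyperplane e × ℝ =>
      cexp (((-2 * Real.pi * (p.2 * r) : ℝ) : ℂ) * I) := Continuous.measurable (by fun_prop)
    simp_rw [hf]
    exact h2.mul this
  have hfn : ∀ η a, ‖f η a‖ = ‖φ (a • e + (η : Eucl n))‖ := by
    intro η a
    rw [hf, norm_mul, norm_exp_ofReal_mul_I, one_mul]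
  have hfB : ∀ η a, ‖f η a‖ ≤ B := fun η a => (hfn η a).le.trans (hB _)
  have hf0 : ∀ (η : hyperplane e) (a : ℝ), φ (a • e + (η : Eucl n)) = 0 → f η a = 0 := fun η a h => by
    rw [hf, h, mul_zero]
  obtain ⟨K, hK⟩ : ∃ K : ℝ → hyperplane e → ℂ, ∀ s η, K s η =
    ∫ a : ℝ, cexp (I * s * (σ * a ^ 2 : ℝ)) * f η a := ⟨_, fun _ _ => rfl⟩
  have hKm : Measurable fun p : ℝ × hyperplane e => K p.1 p.2 := by
    have : StronglyMeasurable fun z : (ℝ × hyperplane e) × ℝ =>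
        cexp (I * z.1.1 * (σ * z.2 ^ 2 : ℝ)) * f z.1.2 z.2 := by
      apply Measurable.stronglyMeasurable
      have h2 : Measurable fun z : (ℝ × hyperplane e) × ℝ =>
        cexp (I * z.1.1 * (σ * z.2 ^ 2 : ℝ)) := Continuous.measurable (by fun_prop)
      have h3 : Measurable fun z : (ℝ × hyperplane e) × ℝ => f z.1.2 z.2 :=
        hfm.comp ((measurable_snd.comp measurable_fst).prodMk measurable_snd)
      exact h2.mul h3
    simp_rw [hK]
    exact (this.integral_prod_right' (ν := (volume : Measure ℝ))).measurable
  have hslice : ∀ s : ℝ, ∫⁻ v : hyperplane e, ‖evolve ε φ s (r • e + (v : Eucl n))‖ₑ ^ 2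
      = ∫⁻ η : hyperplane e, ‖K s η‖ₑ ^ 2 := by
    intro s
    obtain ⟨k, hk⟩ : ∃ k : hyperplane e → ℂ,
      ∀ η, k η = cexp (I * s * quadSym ε (η : Eucl n)) * K s η := ⟨_, fun _ => rfl⟩
    have hev : ∀ v : hyperplane e, evolve ε φ s (r • e + (v : Eucl n)) = 𝓕 k v := by
      intro v
      rw [evolve_orthCoord he hq hφ1 s r]
      have hk' : k = fun η : hyperplane e => cexp (I * s * quadSym ε (η : Eucl n)) * K s η :=
        funext hk
      simp_rw [hk', hK, hf]
    simp_rw [hev]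
    have hkm : Measurable k := by
      have : Measurable fun η : hyperplane e => cexp (I * s * quadSym ε (η : Eucl n)) :=
        Continuous.measurable (by fun_prop)
      simp_rw [funext hk]
      exact this.mul (hKm.comp measurable_prodMk_left)
    have hkn : ∀ η, ‖k η‖ = ‖K s η‖ := fun η => by
      rw [hk, norm_mul, norm_exp_I_mul_ofReal_mul_ofReal, one_mul]
    have hKB : ∀ η, ‖K s η‖ ≤ B * (2 * |M|) := by
      intro η
      have h1 : K s η = ∫ a in Set.Icc (-|M|) |M|, cexp (I * s * (σ * a ^ 2 : ℝ)) * f η a := by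
        rw [hK]
        refine (setIntegral_eq_integral_of_forall_compl_eq_zero fun a ha => ?_).symm
        rw [hf0, mul_zero]
        refine hup _ (lt_of_lt_of_le ?_ (hnorm1 a η))
        by_contra h
        exact ha (abs_le.1 ((not_lt.1 h).trans (le_abs_self M)))
      rw [h1]
      clear h1
      refine (norm_setIntegral_le_of_norm_le_const (C := B) (by simp) fun a _ => ?_).trans ?_
      · rw [norm_mul, norm_exp_I_mul_ofReal_mul_ofReal, one_mul]; exact hfB η a
      · simp [Measure.real, abs_nonneg, ← two_mul]
    have hKs : ∀ η, η ∉ Metric.closedBall (0 : hyperplane e) M → k η = 0 := by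
      intro η hη
      have : ∀ a, f η a = 0 := fun a =>
        hf0 _ _ (hup _ (lt_of_lt_of_le (by simpa using hη) (hnorm2 a η)))
      simp [hk, hK, this]
    have hkp : ∀ p, MemLp k p := fun p => memLp_of_bounded_of_support p hkm
      (fun η => (hkn η).le.trans (hKB η)) measurableSet_closedBall measure_closedBall_lt_top hKs
    have := lintegral_enorm_sq_fourier (memLp_one_iff_integrable.1 (hkp 1)) (hkp 2)
    refine this.trans ?_
    congr 1 with η
    rw [← ofReal_norm, hkn, ofReal_norm]
  have hem : Measurable fun p : ℝ × hyperplane e =>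
      ‖evolve ε φ p.1 (r • e + (p.2 : Eucl n))‖ₑ ^ 2 := by
    refine (Measurable.enorm ?_).pow_const 2
    have hline : Measurable fun p : ℝ × hyperplane e => (p.1, r • e + (p.2 : Eucl n)) :=
      Continuous.measurable (by fun_prop)
    have hcomp := (measurable_evolve ε hφ).comp hline
    exact hcomp
  rw [Measure.volume_eq_prod, lintegral_prod _ hem.aemeasurable]
  simp_rw [hslice]
  rw [lintegral_lintegral_swap (hKm.enorm.pow_const 2).aemeasurable]
  calc ∫⁻ η : hyperplane e, ∫⁻ s : ℝ, ‖K s η‖ₑ ^ 2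
      ≤ ∫⁻ η : hyperplane e, ENNReal.ofReal (Real.pi / c) * ∫⁻ a : ℝ, ‖f η a‖ₑ ^ 2 := by
        refine lintegral_mono fun η => ?_
        simp_rw [hK]
        exact lintegral_enorm_sq_quadratic_phase_le (f := f η) (B := B) (M := M) hc hσ
          (hfm.comp measurable_prodMk_left) (hfB η)
          (fun a ha => hf0 _ _ (hlow _ (by rwa [hcoord])))
          (fun a ha => hf0 _ _ (hup _ (ha.trans_le ((le_abs_self a).trans (hnorm1 a η)))))
    _ = ENNReal.ofReal (Real.pi / c) * ∫⁻ η : hyperplane e, ∫⁻ a : ℝ, ‖f η a‖ₑ ^ 2 :=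
        lintegral_const_mul' _ _ ENNReal.ofReal_ne_top
    _ = ENNReal.ofReal (Real.pi / c) * ∫⁻ ξ, ‖φ ξ‖ₑ ^ 2 := by
        congr 1
        rw [lintegral_eq_lintegral_orthCoord he (hφ.enorm.pow_const 2)]
        refine lintegral_congr fun η => lintegral_congr fun a => ?_
        rw [← ofReal_norm, hfn, ofReal_norm]

/-- Hölder's inequality for the pairing of `L^{1,2}_e` with functions that are uniformly in `L²`
on the hyperplanes `re + P_e`. -/
theorem lintegral_mul_le_aniNorm_mul {n : ℕ} {e : Eucl n} (he : ‖e‖ = 1)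
    {G E : ℝ × Eucl n → ℂ} (hG : Measurable G) (hE : Measurable E) {K : ℝ≥0∞}
    (hK : ∀ r : ℝ, ∫⁻ p : ℝ × hyperplane e, ‖E (p.1, r • e + (p.2 : Eucl n))‖ₑ ^ 2 ≤ K) :
    ∫⁻ s : ℝ, ∫⁻ x : Eucl n, ‖G (s, x)‖ₑ * ‖E (s, x)‖ₑ ≤ aniNorm 1 2 e G * K ^ (1 / 2 : ℝ) := by
  have hline : Measurable fun z : (ℝ × hyperplane e) × ℝ =>
      (z.1.1, z.2 • e + (z.1.2 : Eucl n)) := Continuous.measurable (by fun_prop)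
  have hslice : ∀ r : ℝ, Measurable fun p : ℝ × hyperplane e =>
      (p.1, r • e + (p.2 : Eucl n)) := fun r => Continuous.measurable (by fun_prop)
  have hm : Measurable fun q : ℝ × Eucl n => ‖G q‖ₑ * ‖E q‖ₑ := hG.enorm.mul hE.enorm
  have hm2 : Measurable fun z : (ℝ × hyperplane e) × ℝ =>
      ‖G (z.1.1, z.2 • e + (z.1.2 : Eucl n))‖ₑ * ‖E (z.1.1, z.2 • e + (z.1.2 : Eucl n))‖ₑ := by
    have := hm.comp hline
    exact this
  have hsw : ∫⁻ s : ℝ, ∫⁻ x : Eucl n, ‖G (s, x)‖ₑ * ‖E (s, x)‖ₑ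
      = ∫⁻ r : ℝ, ∫⁻ p : ℝ × hyperplane e,
        ‖G (p.1, r • e + (p.2 : Eucl n))‖ₑ * ‖E (p.1, r • e + (p.2 : Eucl n))‖ₑ := by
    rw [← lintegral_lintegral_swap (f := fun (p : ℝ × hyperplane e) (r : ℝ) =>
      ‖G (p.1, r • e + (p.2 : Eucl n))‖ₑ * ‖E (p.1, r • e + (p.2 : Eucl n))‖ₑ) hm2.aemeasurable,
      Measure.volume_eq_prod, lintegral_prod _ hm2.lintegral_prod_right'.aemeasurable]
    refine lintegral_congr fun s => ?_
    have hs : Measurable fun x : Eucl n => ‖G (s, x)‖ₑ * ‖E (s, x)‖ₑ :=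
      hm.comp measurable_prodMk_left
    exact lintegral_eq_lintegral_orthCoord he hs
  rw [hsw]
  have hani : aniNorm 1 2 e G = ∫⁻ r : ℝ, innerQ 2 e G r := by simp [aniNorm]
  have hinner : ∀ r, innerQ 2 e G r =
      (∫⁻ p : ℝ × hyperplane e, ‖G (p.1, r • e + (p.2 : Eucl n))‖ₑ ^ (2 : ℝ)) ^ (1 / 2 : ℝ) := by
    intro r
    rw [innerQ, eLpNorm_eq_lintegral_rpow_enorm_toReal (by norm_num) (by norm_num)]
    simp
  have hmeas : Measurable fun r => innerQ 2 e G r := by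
    simp_rw [hinner]
    refine Measurable.pow_const ?_ _
    have h1 : Measurable fun z : ℝ × (ℝ × hyperplane e) =>
        ‖G (z.2.1, z.1 • e + (z.2.2 : Eucl n))‖ₑ ^ (2 : ℝ) := by
      have := ((hG.comp (hline.comp measurable_swap)).enorm).pow_const (2 : ℝ)
      exact this
    exact h1.lintegral_prod_right'
  rw [hani, ← lintegral_mul_const _ hmeas]
  refine lintegral_mono fun r => ?_
  have hG' : Measurable fun p : ℝ × hyperplane e => ‖G (p.1, r • e + (p.2 : Eucl n))‖ₑ := by
    have := (hG.comp (hslice r)).enorm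
    exact this
  have hE' : Measurable fun p : ℝ × hyperplane e => ‖E (p.1, r • e + (p.2 : Eucl n))‖ₑ := by
    have := (hE.comp (hslice r)).enorm
    exact this
  refine (ENNReal.lintegral_mul_le_Lp_mul_Lq volume
    (show (2 : ℝ).HolderConjugate 2 from .two_two) hG'.aemeasurable hE'.aemeasurable).trans ?_
  rw [hinner]
  gcongr
  simpa using hK r

/-- The part of the Duhamel integral with frequencies in the half-space `ξ·e ≥ c` is controlled
by the `L^{1,2}_e` norm of the forcing. -/
theorem lintegral_halfspace_enorm_sq_le {n : ℕ} {ε : Fin n → ℝ} {e : Eucl n} {σ : ℝ}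
    (he : ‖e‖ = 1) (hσ : σ = 1 ∨ σ = -1)
    (hq : ∀ (a : ℝ) (η : hyperplane e),
      quadSym ε (a • e + (η : Eucl n)) = σ * a ^ 2 + quadSym ε (η : Eucl n))
    {G : ℝ × Eucl n → ℂ} {g : ℝ → Eucl n → ℂ} {T : Set ℝ} {B c M : ℝ} (hc : 0 < c)
    (hG : Measurable G) (hg : Measurable fun p : ℝ × Eucl n => g p.1 p.2)
    (hgM : ∀ s ξ, M < ‖ξ‖ → g s ξ = 0) (hB0 : 0 ≤ B)
    (hgB : ∀ ξ, ∫⁻ s in T, ‖g s ξ‖ₑ ≤ ENNReal.ofReal B)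
    (hpar : ∀ (s : ℝ) (h : Eucl n → ℂ), Integrable h → MemLp h 2 →
      ∫ ξ, g s ξ * h ξ = ∫ x, G (s, x) * 𝓕 h x)
    {U : Eucl n → ℂ} (hU : ∀ ξ, U ξ = ∫ s in T, cexp (I * s * quadSym ε ξ) * g s ξ) :
    ∫⁻ ξ in {ξ | c ≤ ⟪e, ξ⟫}, ‖U ξ‖ₑ ^ 2
      ≤ ENNReal.ofReal (Real.pi / c) * aniNorm 1 2 e G ^ 2 := by
  have hqc := continuous_quadSym ε
  have hintm : Measurable fun p : ℝ × Eucl n => cexp (I * p.1 * quadSym ε p.2) * g p.1 p.2 := by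
    have h2 : Measurable fun p : ℝ × Eucl n => cexp (I * p.1 * quadSym ε p.2) :=
      Continuous.measurable (by fun_prop)
    exact h2.mul hg
  have hUm : Measurable U := by
    rw [funext hU]
    exact (hintm.stronglyMeasurable.integral_prod_left'
      (μ := (volume : Measure ℝ).restrict T)).measurable
  have hUB : ∀ ξ, ‖U ξ‖ ≤ B := by
    intro ξ
    rw [hU, ← ENNReal.ofReal_le_ofReal_iff hB0, ofReal_norm]
    refine (enorm_integral_le_lintegral_enorm _).trans (le_trans (le_of_eq ?_) (hgB ξ))
    refine lintegral_congr fun s => ?_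
    rw [enorm_mul, ← ofReal_norm (cexp _), norm_exp_I_mul_ofReal_mul_ofReal, ENNReal.ofReal_one,
      one_mul]
  have hUM : ∀ ξ, M < ‖ξ‖ → U ξ = 0 := fun ξ hξ => by simp [hU, hgM _ ξ hξ]
  set A : Set (Eucl n) := {ξ | c ≤ ⟪e, ξ⟫} with hA
  have hAm : MeasurableSet A :=
    measurableSet_le measurable_const (Continuous.measurable (by fun_prop))
  obtain ⟨φ, hφ⟩ : ∃ φ : Eucl n → ℂ, φ = A.indicator fun ξ => starRingEnd ℂ (U ξ) := ⟨_, rfl⟩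
  have hφm : Measurable φ := by
    rw [hφ]; exact (Complex.continuous_conj.measurable.comp hUm).indicator hAm
  have hφU : ∀ ξ, φ ξ * U ξ = ((‖φ ξ‖ ^ 2 : ℝ) : ℂ) := by
    intro ξ
    rw [hφ]
    by_cases h : ξ ∈ A
    · simp [h, conj_mul']
    · simp [h]
  have hφn : ∀ ξ, ‖φ ξ‖ ≤ ‖U ξ‖ := by
    intro ξ
    rw [hφ]
    exact (norm_indicator_le_norm_self _ _).trans_eq (by simp)
  have hφB : ∀ ξ, ‖φ ξ‖ ≤ B := fun ξ => (hφn ξ).trans (hUB ξ)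
  have hφM : ∀ ξ, M < ‖ξ‖ → φ ξ = 0 := fun ξ hξ => by
    have := hφn ξ
    rw [hUM ξ hξ, norm_zero] at this
    exact norm_le_zero_iff.1 this
  have hφA : ∀ ξ, ⟪e, ξ⟫ < c → φ ξ = 0 := fun ξ hξ => by
    rw [hφ, Set.indicator_of_notMem]
    simpa [hA] using hξ
  have hφI : ∫⁻ ξ in A, ‖U ξ‖ₑ ^ 2 = ∫⁻ ξ, ‖φ ξ‖ₑ ^ 2 := by
    rw [← lintegral_indicator hAm]
    refine lintegral_congr fun ξ => ?_
    rw [hφ]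
    by_cases h : ξ ∈ A <;> simp [h, enorm_eq_nnnorm]
  have hφp : ∀ p, MemLp φ p := fun p =>
    memLp_of_bounded_of_support (s := Metric.closedBall 0 M) p hφm hφB measurableSet_closedBall
      measure_closedBall_lt_top fun ξ hξ => hφM ξ (by simpa using hξ)
  have hφ1 := memLp_one_iff_integrable.1 (hφp 1)
  have hsq : Integrable fun ξ => ‖φ ξ‖ ^ 2 := (hφp 2).norm.integrable_sq
  have hIeq : ∫⁻ ξ, ‖φ ξ‖ₑ ^ 2 = ENNReal.ofReal (∫ ξ, ‖φ ξ‖ ^ 2) := by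
    rw [ofReal_integral_eq_lintegral_ofReal hsq (ae_of_all _ fun ξ => by positivity)]
    refine lintegral_congr fun ξ => ?_
    rw [ENNReal.ofReal_pow (norm_nonneg _), ofReal_norm]
  have hIfin : ∫⁻ ξ, ‖φ ξ‖ₑ ^ 2 ≠ ∞ := hIeq ▸ ENNReal.ofReal_ne_top
  have hprod : Integrable (fun p : Eucl n × ℝ =>
      φ p.1 * (cexp (I * p.2 * quadSym ε p.1) * g p.2 p.1))
        ((volume : Measure (Eucl n)).prod (volume.restrict T)) := by
    have hmm : Measurable fun p : Eucl n × ℝ =>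
        φ p.1 * (cexp (I * p.2 * quadSym ε p.1) * g p.2 p.1) := by
      have h1 : Measurable fun p : Eucl n × ℝ => φ p.1 := hφm.comp measurable_fst
      have h2 : Measurable fun p : Eucl n × ℝ =>
          cexp (I * p.2 * quadSym ε p.1) * g p.2 p.1 := by
        have := hintm.comp (measurable_swap (α := Eucl n) (β := ℝ))
        exact this
      exact h1.mul h2
    refine ⟨hmm.aestronglyMeasurable, ?_⟩
    rw [hasFiniteIntegral_iff_enorm, lintegral_prod _ hmm.enorm.aemeasurable]
    refine lt_of_le_of_lt (b := ∫⁻ ξ, ‖φ ξ‖ₑ * ENNReal.ofReal B) (lintegral_mono fun ξ => ?_) ?_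
    · simp only [enorm_mul]
      rw [lintegral_const_mul' _ _ enorm_ne_top]
      gcongr
      refine le_trans (le_of_eq ?_) (hgB ξ)
      refine lintegral_congr fun s => ?_
      rw [← ofReal_norm (cexp _), norm_exp_I_mul_ofReal_mul_ofReal, ENNReal.ofReal_one, one_mul]
    · rw [lintegral_mul_const' _ _ ENNReal.ofReal_ne_top]
      exact ENNReal.mul_lt_top hφ1.2 ENNReal.ofReal_lt_top
  have hdual : ((∫ ξ, ‖φ ξ‖ ^ 2 : ℝ) : ℂ) = ∫ s in T, ∫ x, G (s, x) * evolve ε φ s x := by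
    calc ((∫ ξ, ‖φ ξ‖ ^ 2 : ℝ) : ℂ) = ∫ ξ, φ ξ * U ξ := by
          simp_rw [hφU]; exact integral_ofReal.symm
      _ = ∫ ξ, ∫ s in T, φ ξ * (cexp (I * s * quadSym ε ξ) * g s ξ) := by
          simp_rw [hU, integral_const_mul]
      _ = ∫ s in T, ∫ ξ, φ ξ * (cexp (I * s * quadSym ε ξ) * g s ξ) :=
          integral_integral_swap hprod
      _ = _ := by
          congr 1 with s
          have hph : Measurable fun ξ : Eucl n => cexp (I * s * quadSym ε ξ) :=
            Continuous.measurable (by fun_prop)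
          have hle : ∀ ξ, ‖cexp (I * s * quadSym ε ξ) * φ ξ‖ ≤ B := fun ξ => by
            rw [norm_mul, norm_exp_I_mul_ofReal_mul_ofReal, one_mul]; exact hφB ξ
          have hp : ∀ p, MemLp (fun ξ => cexp (I * s * quadSym ε ξ) * φ ξ) p := fun p =>
            memLp_of_bounded_of_support (s := Metric.closedBall 0 M) p (hph.mul hφm) hle
              measurableSet_closedBall measure_closedBall_lt_top
              fun ξ hξ => by rw [hφM ξ (by simpa using hξ), mul_zero]
          have := hpar s _ (memLp_one_iff_integrable.1 (hp 1)) (hp 2)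
          refine Eq.trans ?_ this
          congr 1 with ξ
          ring
  have hmain : ∫⁻ ξ, ‖φ ξ‖ₑ ^ 2 ≤ aniNorm 1 2 e G *
      (ENNReal.ofReal (Real.pi / c) * ∫⁻ ξ, ‖φ ξ‖ₑ ^ 2) ^ (1 / 2 : ℝ) := by
    calc ∫⁻ ξ, ‖φ ξ‖ₑ ^ 2 = ‖((∫ ξ, ‖φ ξ‖ ^ 2 : ℝ) : ℂ)‖ₑ := by
          rw [hIeq, ← ofReal_norm, norm_real, Real.norm_of_nonneg]
          exact integral_nonneg fun ξ => by positivity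
      _ ≤ ∫⁻ s in T, ‖∫ x, G (s, x) * evolve ε φ s x‖ₑ := by
          rw [hdual]; exact enorm_integral_le_lintegral_enorm _
      _ ≤ ∫⁻ s : ℝ, ∫⁻ x, ‖G (s, x)‖ₑ * ‖evolve ε φ s x‖ₑ := by
          refine (lintegral_mono' Measure.restrict_le_self fun s =>
            enorm_integral_le_lintegral_enorm _).trans (le_of_eq ?_)
          simp only [enorm_mul]
      _ ≤ _ := lintegral_mul_le_aniNorm_mul he hG (measurable_evolve ε hφm) fun r =>
          local_smoothing he hσ hq hc hφm hφB hφA hφM r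
  rw [hφI]
  set J := ∫⁻ ξ, ‖φ ξ‖ₑ ^ 2
  by_cases hJ : J = 0
  · simp [hJ]
  have h2 : J * J ≤ (ENNReal.ofReal (Real.pi / c) * aniNorm 1 2 e G ^ 2) * J := by
    calc J * J ≤ (aniNorm 1 2 e G * (ENNReal.ofReal (Real.pi / c) * J) ^ (1 / 2 : ℝ)) *
          (aniNorm 1 2 e G * (ENNReal.ofReal (Real.pi / c) * J) ^ (1 / 2 : ℝ)) :=
          mul_le_mul' hmain hmain
      _ = aniNorm 1 2 e G ^ 2 * ((ENNReal.ofReal (Real.pi / c) * J) ^ (1 / 2 : ℝ) *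
          (ENNReal.ofReal (Real.pi / c) * J) ^ (1 / 2 : ℝ)) := by ring
      _ = _ := by
          rw [← ENNReal.rpow_add_of_nonneg _ _ (by norm_num) (by norm_num)]
          norm_num
          ring
  exact (ENNReal.mul_le_mul_iff_left hJ hIfin).1 h2

/-- The restriction of a Schwartz function on space-time to a fixed time. -/
def timeSlice {V : Type*} [NormedAddCommGroup V] [NormedSpace ℝ V]
    (F : SchwartzMap (ℝ × V) ℂ) (s : ℝ) : SchwartzMap V ℂ :=
  SchwartzMap.compCLMOfAntilipschitz (K := 1) (g := fun y : V => (s, (0 : V)) + (0, y)) ℂ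
    ((Function.HasTemperateGrowth.const _).add
      (ContinuousLinearMap.inr ℝ ℝ V).hasTemperateGrowth)
    (AntilipschitzWith.of_le_mul_dist fun x y => by simp [Prod.dist_eq]) F

theorem timeSlice_apply {V : Type*} [NormedAddCommGroup V] [NormedSpace ℝ V]
    (F : SchwartzMap (ℝ × V) ℂ) (s : ℝ) (y : V) : timeSlice F s y = F (s, y) := by
  simp [timeSlice]

theorem seminorm_timeSlice_le {V : Type*} [NormedAddCommGroup V] [NormedSpace ℝ V]
    (F : SchwartzMap (ℝ × V) ℂ) (s : ℝ) (k l : ℕ) :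
    SchwartzMap.seminorm ℂ k l (timeSlice F s) ≤ SchwartzMap.seminorm ℂ k l F := by
  refine SchwartzMap.seminorm_le_bound ℂ k l _ (apply_nonneg _ _) fun y => ?_
  have h1 : ⇑(timeSlice F s) =
      (fun z : ℝ × V => F ((s, (0 : V)) + z)) ∘ ContinuousLinearMap.inr ℝ ℝ V := by
    ext y; simp [timeSlice_apply]
  have h2 : ContDiff ℝ l fun z : ℝ × V => F ((s, (0 : V)) + z) :=
    (F.smooth l).comp (contDiff_const.add contDiff_id)
  rw [h1, ContinuousLinearMap.iteratedFDeriv_comp_right _ h2 _ le_rfl,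
    iteratedFDeriv_comp_add_left]
  have h3 : ‖(ContinuousLinearMap.inr ℝ ℝ V)‖ ≤ 1 :=
    ContinuousLinearMap.opNorm_le_bound _ zero_le_one fun x => by simp [Prod.norm_def]
  have h4 : ‖y‖ ≤ ‖(s, (0 : V)) + ContinuousLinearMap.inr ℝ ℝ V y‖ := by simp [Prod.norm_def]
  refine le_trans ?_ (SchwartzMap.le_seminorm ℂ k l F ((s, (0 : V)) + ContinuousLinearMap.inr ℝ ℝ V y))
  refine mul_le_mul (pow_le_pow_left₀ (norm_nonneg _) h4 k) ?_ (norm_nonneg _) (by positivity)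
  refine (ContinuousMultilinearMap.norm_compContinuousLinearMap_le _ _).trans ?_
  refine mul_le_of_le_one_right (norm_nonneg _) ?_
  exact Finset.prod_le_one (fun _ _ => norm_nonneg _) fun _ _ => h3

/-- The Fourier transforms in space of the time slices of a Schwartz function are uniformly
bounded in `L¹`. -/
theorem exists_lintegral_fourier_timeSlice_le {V : Type*} [NormedAddCommGroup V]
    [InnerProductSpace ℝ V] [FiniteDimensional ℝ V] [MeasurableSpace V] [BorelSpace V]
    (F : SchwartzMap (ℝ × V) ℂ) :
    ∃ C : ℝ, ∀ s, ∫⁻ ξ, ‖𝓕 (fun y => F (s, y)) ξ‖ₑ ≤ ENNReal.ofReal C := by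
  let T : SchwartzMap V ℂ →L[ℂ] Lp ℂ 1 (volume : Measure V) :=
    (SchwartzMap.toLpCLM ℂ ℂ 1 volume) ∘L (FourierTransform.fourierCLM ℂ (SchwartzMap V ℂ))
  let q : Seminorm ℂ (SchwartzMap V ℂ) := 
    (normSeminorm ℂ (Lp ℂ 1 (volume : Measure V))).comp T.toLinearMap
  have hq : Continuous q := continuous_norm.comp T.continuous
  obtain ⟨S, C, -, hC⟩ := Seminorm.bound_of_continuous (schwartz_withSeminorms ℂ V ℂ) q hq
  refine ⟨C * S.sup (schwartzSeminormFamily ℂ (ℝ × V) ℂ) F, fun s => ?_⟩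
  have h1 : q (timeSlice F s) ≤ C * S.sup (schwartzSeminormFamily ℂ (ℝ × V) ℂ) F := by
    refine (hC _).trans ?_
    rw [smul_apply, NNReal.smul_def, smul_eq_mul]
    gcongr
    refine Seminorm.finset_sup_apply_le (apply_nonneg _ _) fun i hi => ?_
    exact (seminorm_timeSlice_le F s i.1 i.2).trans
      (Seminorm.le_finset_sup_apply (p := schwartzSeminormFamily ℂ (ℝ × V) ℂ) hi)
  obtain ⟨Φ, hΦ⟩ : ∃ Φ : SchwartzMap V ℂ, Φ = 𝓕 (timeSlice F s) := ⟨_, rfl⟩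
  have h2 : q (timeSlice F s) = (eLpNorm Φ 1 volume).toReal := by
    rw [← SchwartzMap.norm_toLp, hΦ]
    rfl
  have h3 : eLpNorm Φ 1 volume = ∫⁻ ξ, ‖𝓕 (fun y => F (s, y)) ξ‖ₑ := by
    rw [eLpNorm_one_eq_lintegral_enorm, hΦ, SchwartzMap.fourier_coe]
    simp only [funext (timeSlice_apply F s)]
  rw [← h3, ← ENNReal.ofReal_toReal (Φ.memLp 1 volume).2.ne, ← h2]
  exact ENNReal.ofReal_le_ofReal h1

/-- The Fourier transform of an inverse Fourier integral: either the original function is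
recovered, or the inverse Fourier integral is not integrable and the outcome vanishes. -/
theorem fourier_fourierInv_eq_self_or_eq_zero {V : Type*} [NormedAddCommGroup V] [InnerProductSpace ℝ V]
    [FiniteDimensional ℝ V] [MeasurableSpace V] [BorelSpace V] {h : V → ℂ}
    (hc : Continuous h) (hi : Integrable h) : 𝓕 (𝓕⁻ h) = h ∨ 𝓕 (𝓕⁻ h) = 0 := by
  by_cases hI : Integrable (𝓕⁻ h)
  · left
    refine hc.fourier_fourierInv_eq hi ?_
    have h1 : 𝓕 h = fun x => 𝓕⁻ h (-x) := by
      ext x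
      rw [Real.fourierInv_eq_fourier_neg, neg_neg]
    rw [h1]
    exact hI.comp_neg
  · right
    ext ξ
    rw [Real.fourier_eq, Pi.zero_apply]
    refine integral_undef fun h2 => hI ?_
    exact (Real.fourierIntegral_convergent_iff ξ).1 h2

/-- The inverse Fourier integral commutes with absolutely convergent integrals in a parameter. -/
theorem setIntegral_fourierInv {V : Type*} [NormedAddCommGroup V] [InnerProductSpace ℝ V]
    [FiniteDimensional ℝ V] [MeasurableSpace V] [BorelSpace V] {T : Set ℝ} {k : ℝ → V → ℂ}
    (hk : Integrable (fun p : ℝ × V => k p.1 p.2) ((volume.restrict T).prod volume)) (x : V) :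
    ∫ s in T, 𝓕⁻ (k s) x = 𝓕⁻ (fun ξ => ∫ s in T, k s ξ) x := by
  simp_rw [Real.fourierInv_eq', smul_eq_mul, ← integral_const_mul]
  refine integral_integral_swap ?_
  refine hk.bdd_mul (c := 1) ?_ (ae_of_all _ fun p => (norm_exp_ofReal_mul_I _).le)
  have h1 : Continuous fun p : ℝ × V => cexp (((2 * Real.pi * ⟪p.2, x⟫ : ℝ) : ℂ) * I) := by
    fun_prop
  exact h1.aestronglyMeasurable

theorem measurable_psiR {χ : ℝ → ℝ} (hχ : IsBump χ) : Measurable (psiR χ) := by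
  have := (hχ.smooth 0).continuous
  unfold psiR
  exact Continuous.measurable (by fun_prop)

theorem psiR_ne_zero {χ : ℝ → ℝ} (hχ : IsBump χ) {s : ℝ} (h : psiR χ s ≠ 0) :
    1 / 2 ≤ |s| ∧ |s| ≤ 2 := by
  by_contra hs
  rw [not_and_or, not_le, not_le] at hs
  refine h ?_
  have h0 := abs_nonneg s
  rcases hs with hs | hs
  · rw [psiR, hχ.one, hχ.one, sub_self]
    · rw [abs_mul, abs_abs, abs_two]; linarith
    · rw [abs_abs]; linarith
  · rw [psiR, hχ.supp, hχ.supp, sub_self]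
    · rw [abs_mul, abs_abs, abs_two]; linarith
    · rw [abs_abs]; exact hs.le

theorem exists_abs_psiR_le {χ : ℝ → ℝ} (hχ : IsBump χ) : ∃ B : ℝ, ∀ s, |psiR χ s| ≤ B := by
  have hc : Continuous χ := (hχ.smooth 0).continuous
  have hs : HasCompactSupport χ :=
    HasCompactSupport.intro (isCompact_Icc (a := (-2 : ℝ)) (b := 2)) fun x hx =>
      hχ.supp x (le_of_not_gt fun h => hx (abs_le.1 h.le))
  obtain ⟨B, hB⟩ := hs.exists_bound_of_continuous hc
  refine ⟨B + B, fun s => (abs_sub _ _).trans (add_le_add ?_ ?_)⟩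
  · exact hB _
  · exact hB _

theorem half_zpow_le_norm_of_psiR_ne_zero {n : ℕ} {χ : ℝ → ℝ} (hχ : IsBump χ) {j : ℤ}
    {ξ : Eucl n} (h : psiR χ ((2 : ℝ) ^ (-j) * ‖ξ‖) ≠ 0) :
    (2 : ℝ) ^ j / 2 ≤ ‖ξ‖ ∧ ‖ξ‖ ≤ 2 * (2 : ℝ) ^ j := by
  have h2 : (0 : ℝ) < 2 ^ j := by positivity
  have := psiR_ne_zero hχ h
  rw [zpow_neg, abs_of_nonneg (by positivity), inv_mul_eq_div, div_le_iff₀ h2,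
    le_div_iff₀ h2] at this
  constructor <;> linarith

/-- The quadratic symbol splits along a coordinate direction. -/
theorem quadSym_coord {n : ℕ} (ε : Fin n → ℝ) (k : Fin n) {τ : ℝ} (hτ : τ = 1 ∨ τ = -1)
    (a : ℝ) (η : hyperplane (EuclideanSpace.single k τ : Eucl n)) :
    quadSym ε (a • (EuclideanSpace.single k τ : Eucl n) + (η : Eucl n))
      = ε k * a ^ 2 + quadSym ε (η : Eucl n) := by
  have hη : (η : Eucl n) k = 0 := by
    have h1 : ⟪(EuclideanSpace.single k τ : Eucl n), (η : Eucl n)⟫ = 0 :=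
      Submodule.mem_orthogonal_singleton_iff_inner_right.1 η.2
    rw [EuclideanSpace.inner_single_left] at h1
    rcases hτ with rfl | rfl <;> simpa using h1
  have hτ2 : τ ^ 2 = 1 := by rcases hτ with rfl | rfl <;> norm_num
  have h2 : ε k * a ^ 2 = ∑ i, if i = k then ε k * a ^ 2 else 0 := by simp
  rw [quadSym, quadSym, h2, ← Finset.sum_add_distrib]
  refine Finset.sum_congr rfl fun i _ => ?_
  by_cases hi : i = k
  · subst hi
    simp [hη, mul_pow, hτ2]
  · simp [hi]

/-- A vector of norm at least `m` has a coordinate of size at least `m / n`. -/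
theorem exists_le_inner_single {n : ℕ} (hn : 0 < n) {ξ : Eucl n} {m : ℝ} (h : m ≤ ‖ξ‖) :
    ∃ k : Fin n, m / n ≤ ⟪(EuclideanSpace.single k 1 : Eucl n), ξ⟫ ∨
      m / n ≤ ⟪(EuclideanSpace.single k (-1) : Eucl n), ξ⟫ := by
  by_contra! hk
  have hn' : (0 : ℝ) < n := by exact_mod_cast hn
  have h1 : ∀ k, |ξ k| < m / n := fun k => by
    have := hk k
    simp only [EuclideanSpace.inner_single_left, map_one, one_mul, map_neg, neg_mul] at this
    exact abs_lt.2 ⟨by linarith [this.2], this.1⟩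
  have h2 : ‖ξ‖ ≤ ∑ k, |ξ k| := by
    rw [EuclideanSpace.norm_eq, Real.sqrt_le_left (Finset.sum_nonneg fun _ _ => abs_nonneg _)]
    simpa using Finset.sum_sq_le_sq_sum_of_nonneg (s := Finset.univ) (f := fun k => |ξ k|)
      (fun _ _ => abs_nonneg _)
  have : Nonempty (Fin n) := ⟨⟨0, hn⟩⟩
  have h3 : ∑ k, |ξ k| < ∑ _k : Fin n, m / n :=
    Finset.sum_lt_sum_of_nonempty Finset.univ_nonempty fun k _ => h1 k
  rw [Finset.sum_const, Finset.card_univ, Fintype.card_fin, nsmul_eq_mul,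
    mul_div_cancel₀ _ hn'.ne'] at h3
  linarith

/-- An integral is bounded by the sum of the integrals over sets covering the support. -/
theorem lintegral_le_sum_setLIntegral {α ι : Type*} [MeasurableSpace α] {μ : Measure α}
    [Fintype ι] {A : ι → Set α} {f : α → ℝ≥0∞} (hf : ∀ x, f x ≠ 0 → ∃ i, x ∈ A i) :
    ∫⁻ x, f x ∂μ ≤ ∑ i, ∫⁻ x in A i, f x ∂μ := by
  calc ∫⁻ x, f x ∂μ ≤ ∫⁻ x in ⋃ i, A i, f x ∂μ := by
        refine (lintegral_mono fun x => ?_).trans (lintegral_indicator_le _ _)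
        by_cases hx : f x = 0
        · simp [hx]
        · rw [Set.indicator_of_mem (Set.mem_iUnion.2 (hf x hx))]
    _ ≤ ∑' i, ∫⁻ x in A i, f x ∂μ := lintegral_iUnion_le _ _
    _ = ∑ i, ∫⁻ x in A i, f x ∂μ := tsum_fintype _

theorem measurable_fourier_slice {n : ℕ} {F : ℝ × Eucl n → ℂ} (hF : Continuous F) :
    Measurable fun p : ℝ × Eucl n => 𝓕 (fun y => F (p.1, y)) p.2 := by
  have h0 : Continuous fun z : (ℝ × Eucl n) × Eucl n =>
      cexp (((-2 * Real.pi * ⟪z.2, z.1.2⟫ : ℝ) : ℂ) * I) • F (z.1.1, z.2) := by fun_prop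
  have h := (h0.stronglyMeasurable.integral_prod_right'
    (ν := (volume : Measure (Eucl n)))).measurable
  simpa only [Real.fourier_eq'] using h

theorem measurable_fourierInv_slice {n : ℕ} {g : ℝ → Eucl n → ℂ}
    (hg : Measurable fun p : ℝ × Eucl n => g p.1 p.2) :
    Measurable fun p : ℝ × Eucl n => 𝓕⁻ (g p.1) p.2 := by
  have h1 : Continuous fun z : (ℝ × Eucl n) × Eucl n =>
      cexp (((2 * Real.pi * ⟪z.2, z.1.2⟫ : ℝ) : ℂ) * I) := by fun_prop
  have h2 : Measurable fun z : (ℝ × Eucl n) × Eucl n => g z.1.1 z.2 := by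
    have h3 : Measurable fun z : (ℝ × Eucl n) × Eucl n => (z.1.1, z.2) := by fun_prop
    have := hg.comp h3
    exact this
  have h3 : Measurable fun z : (ℝ × Eucl n) × Eucl n =>
      cexp (((2 * Real.pi * ⟪z.2, z.1.2⟫ : ℝ) : ℂ) * I) * g z.1.1 z.2 := h1.measurable.mul h2
  have h := (h3.stronglyMeasurable.integral_prod_right'
    (ν := (volume : Measure (Eucl n)))).measurable
  simpa only [Real.fourierInv_eq', smul_eq_mul] using h

theorem enorm_fourier_le_lintegral {V : Type*} [NormedAddCommGroup V] [InnerProductSpace ℝ V]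
    [FiniteDimensional ℝ V] [MeasurableSpace V] [BorelSpace V] (f : V → ℂ) (ξ : V) :
    ‖𝓕 f ξ‖ₑ ≤ ∫⁻ x, ‖f x‖ₑ := by
  rw [Real.fourier_eq']
  refine (enorm_integral_le_lintegral_enorm _).trans (le_of_eq (lintegral_congr fun x => ?_))
  rw [enorm_smul, ← ofReal_norm (cexp _), norm_exp_ofReal_mul_I, ENNReal.ofReal_one, one_mul]

/-- The retarded Duhamel integral as an inverse Fourier integral. -/
theorem exists_duhamel_eq_fourierInv {n : ℕ} (ε : Fin n → ℝ) (F : SchwartzMap (ℝ × Eucl n) ℂ)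
    (t : ℝ) : ∃ (c : ℂ) (H : Eucl n → ℂ), ‖c‖ = 1 ∧ Continuous H ∧ Integrable H ∧
      (fun x => duhamel ε (fun q => F q) (t, x)) = 𝓕⁻ H ∧
      ∀ ξ, H ξ = c * (cexp (-I * t * quadSym ε ξ) * ∫ s in Set.uIoc 0 t,
        cexp (I * s * quadSym ε ξ) * 𝓕 (fun y => F (s, y)) ξ) := by
  obtain ⟨c, hc1, hc⟩ : ∃ c : ℂ, ‖c‖ = 1 ∧ ∀ f : ℝ → ℂ,
      ∫ s in (0 : ℝ)..t, f s = c * ∫ s in Set.uIoc 0 t, f s := by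
    by_cases h : 0 ≤ t
    · exact ⟨1, by simp, fun f => by simp [intervalIntegral.intervalIntegral_eq_integral_uIoc, h]⟩
    · exact ⟨-1, by simp, fun f => by simp [intervalIntegral.intervalIntegral_eq_integral_uIoc, h]⟩
  have hqc := continuous_quadSym ε
  have hFm := measurable_fourier_slice F.continuous
  obtain ⟨k, hk⟩ : ∃ k : ℝ → Eucl n → ℂ, ∀ s ξ, k s ξ =
      c * (cexp (-I * ((t - s : ℝ) : ℂ) * quadSym ε ξ) * 𝓕 (fun y => F (s, y)) ξ) :=
    ⟨_, fun _ _ => rfl⟩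
  have hkn : ∀ s ξ, ‖k s ξ‖ₑ = ‖𝓕 (fun y => F (s, y)) ξ‖ₑ := fun s ξ => by
    have h1 : cexp (-I * ((t - s : ℝ) : ℂ) * quadSym ε ξ)
        = cexp (I * ((s - t : ℝ) : ℂ) * quadSym ε ξ) := by
      congr 1; push_cast; ring
    rw [hk, h1, ← ofReal_norm, norm_mul, norm_mul, hc1, norm_exp_I_mul_ofReal_mul_ofReal,
      one_mul, one_mul, ofReal_norm]
  have hkm : Measurable fun p : ℝ × Eucl n => k p.1 p.2 := by
    simp only [hk]
    have h1 : Measurable fun p : ℝ × Eucl n =>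
        cexp (-I * ((t - p.1 : ℝ) : ℂ) * quadSym ε p.2) := Continuous.measurable (by fun_prop)
    exact (h1.mul hFm).const_mul c
  have hkint : Integrable (fun p : ℝ × Eucl n => k p.1 p.2)
      ((volume.restrict (Set.uIoc 0 t)).prod volume) := by
    obtain ⟨C, hC⟩ := exists_lintegral_fourier_timeSlice_le F
    refine ⟨hkm.aestronglyMeasurable, ?_⟩
    rw [hasFiniteIntegral_iff_enorm, lintegral_prod _ hkm.enorm.aemeasurable]
    simp only [hkn]
    refine (lintegral_mono hC).trans_lt ?_
    rw [lintegral_const]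
    refine ENNReal.mul_lt_top ENNReal.ofReal_lt_top ?_
    rw [Measure.restrict_apply_univ, Set.uIoc]
    exact measure_Ioc_lt_top
  have hkc : ∀ s, Continuous (k s) := fun s => by
    have h1 : Continuous (𝓕 fun y => F (s, y)) := by
      rw [← funext (timeSlice_apply F s)]
      exact VectorFourier.fourierIntegral_continuous Real.continuous_fourierChar
        (by exact continuous_inner) (timeSlice F s).integrable
    rw [funext (hk s)]
    fun_prop
  refine ⟨c, fun ξ => ∫ s in Set.uIoc 0 t, k s ξ, hc1, ?_, hkint.integral_prod_right, ?_, ?_⟩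
  · have hFi : Integrable (fun p : ℝ × Eucl n => F p)
        ((volume : Measure ℝ).prod (volume : Measure (Eucl n))) := F.integrable
    have ha : Integrable (fun s => ∫ y, ‖F (s, y)‖) (volume : Measure ℝ) :=
      hFi.norm.integral_prod_left
    refine continuous_of_dominated (bound := fun s => ∫ y, ‖F (s, y)‖)
      (fun ξ => (hkm.comp measurable_prodMk_right).aestronglyMeasurable)
      (fun ξ => ae_of_all _ fun s => ?_) ha.restrict (ae_of_all _ hkc)
    have h2 : Integrable (fun y => F (s, y)) := by
      rw [← funext (timeSlice_apply F s)]; exact (timeSlice F s).integrable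
    rw [← ENNReal.ofReal_le_ofReal_iff (integral_nonneg fun _ => norm_nonneg _), ofReal_norm, hkn,
      ofReal_integral_norm_eq_lintegral_enorm h2]
    exact enorm_fourier_le_lintegral _ _
  · ext x
    rw [← setIntegral_fourierInv hkint, duhamel, hc, ← integral_const_mul]
    congr 1 with s
    rw [prop, mulOp, Real.fourierInv_eq', Real.fourierInv_eq', ← integral_const_mul]
    congr 1 with ξ
    rw [hk, smul_eq_mul, smul_eq_mul]
    push_cast
    ring
  · intro ξ
    simp only [hk]
    rw [integral_const_mul, ← integral_const_mul (cexp _)]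
    congr 2 with s
    rw [← mul_assoc, ← Complex.exp_add]
    congr 2
    push_cast
    ring

/-- The `L²` bound for the frequency-localized retarded integral at a fixed time. -/
theorem eLpNorm_projT_duhamel_le {n : ℕ} (hn : 0 < n) {ε : Fin n → ℝ}
    (hε : ∀ i, ε i = 1 ∨ ε i = -1) {χ : ℝ → ℝ} (hχ : IsBump χ)
    (F : SchwartzMap (ℝ × Eucl n) ℂ) (j : ℤ) (t : ℝ) :
    eLpNorm (fun x => projT χ j (duhamel ε (fun q => F q)) (t, x)) 2 volume ≤
      (∑ _i : Fin n × Bool, ENNReal.ofReal (Real.pi / ((2 : ℝ) ^ j / 2 / n)) *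
        sphSup (fun e => aniNorm 1 2 e (projT χ j (fun q => F q))) ^ 2) ^ (1 / 2 : ℝ) := by
  obtain ⟨c, H, hc, hHc, hHi, hD, hH⟩ := exists_duhamel_eq_fourierInv ε F t
  obtain ⟨A, hA⟩ := exists_abs_psiR_le hχ
  have hA0 : 0 ≤ A := (abs_nonneg _).trans (hA 0)
  obtain ⟨m, hm⟩ : ∃ m : Eucl n → ℂ, ∀ ξ, m ξ = (psiR χ ((2 : ℝ) ^ (-j) * ‖ξ‖) : ℂ) :=
    ⟨_, fun _ => rfl⟩
  have hmm : Measurable m := by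
    rw [funext hm]
    exact measurable_ofReal.comp ((measurable_psiR hχ).comp (measurable_norm.const_mul _))
  have hmA : ∀ ξ, ‖m ξ‖ₑ ≤ ENNReal.ofReal A := fun ξ => by
    rw [← ofReal_norm, hm, norm_real]
    exact ENNReal.ofReal_le_ofReal (hA _)
  have hms : ∀ ξ, m ξ ≠ 0 → (2 : ℝ) ^ j / 2 ≤ ‖ξ‖ ∧ ‖ξ‖ ≤ 2 * (2 : ℝ) ^ j := fun ξ h =>
    half_zpow_le_norm_of_psiR_ne_zero hχ fun h0 => h (by rw [hm, h0, ofReal_zero])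
  obtain ⟨g, hg⟩ : ∃ g : ℝ → Eucl n → ℂ, ∀ s ξ, g s ξ = m ξ * 𝓕 (fun y => F (s, y)) ξ :=
    ⟨_, fun _ _ => rfl⟩
  have hgm : Measurable fun p : ℝ × Eucl n => g p.1 p.2 := by
    simp only [hg]
    have h1 : Measurable fun p : ℝ × Eucl n => m p.2 := hmm.comp measurable_snd
    exact h1.mul (measurable_fourier_slice F.continuous)
  have hgM : ∀ s ξ, 2 * (2 : ℝ) ^ j < ‖ξ‖ → g s ξ = 0 := fun s ξ h => by
    have : m ξ = 0 := by_contra fun h0 => absurd (hms ξ h0).2 h.not_ge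
    rw [hg, this, zero_mul]
  have hgle : ∀ s ξ, ‖g s ξ‖ₑ ≤ ENNReal.ofReal A * ∫⁻ y, ‖F (s, y)‖ₑ := fun s ξ => by
    rw [hg, enorm_mul]
    exact mul_le_mul' (hmA ξ) (enorm_fourier_le_lintegral _ _)
  have hFs : ∀ s, Integrable fun y => F (s, y) := fun s => by
    rw [← funext (timeSlice_apply F s)]; exact (timeSlice F s).integrable
  obtain ⟨B, hB0, hB⟩ : ∃ B : ℝ, 0 ≤ B ∧
      ∀ ξ, ∫⁻ s in Set.uIoc 0 t, ‖g s ξ‖ₑ ≤ ENNReal.ofReal B := by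
    have hFi : Integrable (fun p : ℝ × Eucl n => F p)
        ((volume : Measure ℝ).prod (volume : Measure (Eucl n))) := F.integrable
    refine ⟨A * ∫ p, ‖F p‖ ∂(volume.prod volume), mul_nonneg hA0 (integral_nonneg fun _ => norm_nonneg _), fun ξ => ?_⟩
    rw [ENNReal.ofReal_mul hA0, ofReal_integral_norm_eq_lintegral_enorm hFi,
      lintegral_prod _ hFi.1.enorm,
      ← lintegral_const_mul' _ _ ENNReal.ofReal_ne_top]
    exact lintegral_mono' Measure.restrict_le_self fun s => hgle s ξ
  have hgp : ∀ s p, MemLp (g s) p := fun s p =>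
    memLp_of_bounded_of_support (s := Metric.closedBall 0 (2 * (2 : ℝ) ^ j))
      (B := A * ∫ y, ‖F (s, y)‖) p
      (by have := hgm.comp (measurable_prodMk_left (x := s)); exact this)
      (fun ξ => by
        rw [← ENNReal.ofReal_le_ofReal_iff
          (mul_nonneg hA0 (integral_nonneg fun _ => norm_nonneg _)), ofReal_norm,
          ENNReal.ofReal_mul hA0, ofReal_integral_norm_eq_lintegral_enorm (hFs s)]
        exact hgle s ξ)
      measurableSet_closedBall measure_closedBall_lt_top
      fun ξ hξ => hgM s ξ (by simpa using hξ)
  obtain ⟨G, hGF, hG⟩ : ∃ G : ℝ × Eucl n → ℂ, G = projT χ j (fun q => F q) ∧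
      ∀ s x, G (s, x) = 𝓕⁻ (g s) x :=
    ⟨_, rfl, fun s x => by simp only [projT, proj, mulOp, funext (hg s), hm]⟩
  have hGm : Measurable G := by
    have h1 : G = fun p => 𝓕⁻ (g p.1) p.2 := funext fun p => hG p.1 p.2
    rw [h1]
    exact measurable_fourierInv_slice hgm
  have hpar : ∀ (s : ℝ) (h : Eucl n → ℂ), Integrable h → MemLp h 2 →
      ∫ ξ, g s ξ * h ξ = ∫ x, G (s, x) * 𝓕 h x := fun s h h1 h2 => by
    simp only [hG]
    exact integral_mul_eq_integral_fourierInv_mul_fourier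
      (memLp_one_iff_integrable.1 (hgp s 1)) (hgp s 2) h1 h2
  obtain ⟨U, hU⟩ : ∃ U : Eucl n → ℂ, ∀ ξ,
      U ξ = ∫ s in Set.uIoc 0 t, cexp (I * s * quadSym ε ξ) * g s ξ := ⟨_, fun _ => rfl⟩
  have hUm : ∀ ξ, U ξ = m ξ * ∫ s in Set.uIoc 0 t,
      cexp (I * s * quadSym ε ξ) * 𝓕 (fun y => F (s, y)) ξ := fun ξ => by
    rw [hU, ← integral_const_mul]
    congr 1 with s
    rw [hg]
    ring
  have hmH : ∀ ξ, ‖m ξ * H ξ‖ = ‖U ξ‖ := fun ξ => by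
    have h1 : cexp (-I * t * quadSym ε ξ) = cexp (I * ((-t : ℝ) : ℂ) * quadSym ε ξ) := by
      congr 1; push_cast; ring
    rw [hH, hUm, h1, norm_mul, norm_mul, norm_mul, norm_mul, hc,
      norm_exp_I_mul_ofReal_mul_ofReal, one_mul, one_mul]
  have hUB : ∀ ξ, ‖U ξ‖ ≤ B := fun ξ => by
    rw [hU, ← ENNReal.ofReal_le_ofReal_iff hB0, ofReal_norm]
    refine (enorm_integral_le_lintegral_enorm _).trans (le_trans (le_of_eq ?_) (hB ξ))
    refine lintegral_congr fun s => ?_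
    rw [enorm_mul, ← ofReal_norm (cexp _), norm_exp_I_mul_ofReal_mul_ofReal, ENNReal.ofReal_one,
      one_mul]
  have hmHp : ∀ p, MemLp (fun ξ => m ξ * H ξ) p := fun p =>
    memLp_of_bounded_of_support (s := Metric.closedBall 0 (2 * (2 : ℝ) ^ j)) p
      (hmm.mul hHc.measurable) (fun ξ => (hmH ξ).trans_le (hUB ξ))
      measurableSet_closedBall measure_closedBall_lt_top fun ξ hξ => by
        have : m ξ = 0 := by_contra fun h0 => hξ (by simpa using (hms ξ h0).2)
        rw [this, zero_mul]
  have hproj : (fun x => projT χ j (duhamel ε (fun q => F q)) (t, x))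
      = 𝓕⁻ (fun ξ => m ξ * 𝓕 (𝓕⁻ H) ξ) := by
    ext x
    simp only [projT, proj, mulOp, hD, hm]
  have hred : eLpNorm (fun x => projT χ j (duhamel ε (fun q => F q)) (t, x)) 2 volume
      ≤ eLpNorm U 2 volume := by
    rw [hproj]
    rcases fourier_fourierInv_eq_self_or_eq_zero hHc hHi with h | h
    · rw [h, eLpNorm_fourierInv_eq (memLp_one_iff_integrable.1 (hmHp 1)) (hmHp 2)]
      exact (eLpNorm_congr_norm_ae (ae_of_all _ hmH)).le
    · have h0 : 𝓕⁻ (fun ξ => m ξ * 𝓕 (𝓕⁻ H) ξ) = 0 := by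
        ext x
        simp [h, Real.fourierInv_eq']
      rw [h0, eLpNorm_zero]
      exact zero_le
  refine hred.trans ?_
  rw [eLpNorm_eq_lintegral_rpow_enorm_toReal (by norm_num) (by norm_num), ENNReal.toReal_ofNat]
  refine ENNReal.rpow_le_rpow ?_ (by norm_num)
  simp only [ENNReal.rpow_two]
  let τ : Bool → ℝ := fun b => if b then 1 else -1
  have hτ : ∀ b, τ b = 1 ∨ τ b = -1 := by simp [τ]
  have h2j : (0 : ℝ) < 2 ^ j := by positivity
  have hn' : (0 : ℝ) < n := by exact_mod_cast hn
  refine (lintegral_le_sum_setLIntegral (A := fun i : Fin n × Bool =>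
    {ξ | (2 : ℝ) ^ j / 2 / n ≤ ⟪(EuclideanSpace.single i.1 (τ i.2) : Eucl n), ξ⟫})
    fun ξ hξ => ?_).trans (Finset.sum_le_sum fun i _ => ?_)
  · have hmξ : m ξ ≠ 0 := fun h0 => hξ (by simp [hUm, h0])
    obtain ⟨k, hk | hk⟩ := exists_le_inner_single hn (hms ξ hmξ).1
    · exact ⟨(k, true), by simpa [τ] using hk⟩
    · exact ⟨(k, false), by simpa [τ] using hk⟩
  · have he : ‖(EuclideanSpace.single i.1 (τ i.2) : Eucl n)‖ = 1 := by
      rcases hτ i.2 with h | h <;> simp [h]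
    refine (lintegral_halfspace_enorm_sq_le he (hε i.1) (quadSym_coord ε i.1 (hτ i.2))
      (by positivity) hGm hgm hgM hB0 hB hpar hU).trans ?_
    gcongr
    rw [← hGF]
    exact le_iSup₂ (f := fun (e : Eucl n) (_ : ‖e‖ = 1) => aniNorm 1 2 e G) _ he

/-- `‖P_j ∫_0^t W_±(t-s)F(s)ds‖_{L^∞_t L²_x}
≤ C 2^{-j/2} sup_e ‖P_j F‖_{L^{1,2}_e}`. -/
theorem duhamel_energy_estimate
    (n : ℕ) (hn : 2 ≤ n) (ε : Fin n → ℝ) (hε : ∀ i, ε i = 1 ∨ ε i = -1)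
    (χ : ℝ → ℝ) (hχ : IsBump χ) :
    ∃ C : ℝ, 0 < C ∧ ∀ (F : SchwartzMap (ℝ × Eucl n) ℂ) (j : ℤ),
      mixNorm ∞ 2 (projT χ j (duhamel ε (fun q => F q)))
      ≤ ENNReal.ofReal C * tp (-(j : ℝ) / 2) *
          sphSup (fun e => aniNorm 1 2 e (projT χ j (fun q => F q))) := by
  have hn' : (0 : ℝ) < n := by exact_mod_cast (by omega : 0 < n)
  refine ⟨4 * n, by positivity, fun F j => ?_⟩
  rw [mixNorm, if_pos rfl]
  refine essSup_le_of_ae_le _ (ae_of_all _ fun t => ?_)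
  refine (eLpNorm_projT_duhamel_le (by omega) hε hχ F j t).trans ?_
  set N := sphSup (fun e => aniNorm 1 2 e (projT χ j (fun q => F q)))
  have h1 : ENNReal.ofReal (4 * n) * tp (-(j : ℝ) / 2) * N
      = ((ENNReal.ofReal (4 * n) * tp (-(j : ℝ) / 2) * N) ^ 2) ^ (1 / 2 : ℝ) := by
    rw [← ENNReal.rpow_two, ← ENNReal.rpow_mul]
    norm_num
  rw [h1]
  refine ENNReal.rpow_le_rpow ?_ (by norm_num)
  have h2j : (0 : ℝ) < 2 ^ j := by positivity
  have h2 : ((2 : ℝ) ^ (-(j : ℝ) / 2)) ^ 2 = ((2 : ℝ) ^ j)⁻¹ := by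
    rw [← Real.rpow_natCast, ← Real.rpow_mul (by norm_num), ← Real.rpow_intCast,
      ← Real.rpow_neg (by norm_num)]
    congr 1
    push_cast
    ring
  rw [Finset.sum_const, Finset.card_univ, Fintype.card_prod, Fintype.card_fin, Fintype.card_bool,
    nsmul_eq_mul, mul_pow, ← mul_assoc]
  gcongr
  rw [tp, ← ENNReal.ofReal_mul (by positivity), ← ENNReal.ofReal_pow (by positivity), mul_pow, h2,
    ← ENNReal.ofReal_natCast, ← ENNReal.ofReal_mul (by positivity)]
  refine ENNReal.ofReal_le_ofReal ?_
  push_cast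
  have h3 : (n : ℝ) * 2 * (Real.pi / (2 ^ j / 2 / n)) = 4 * n ^ 2 * Real.pi * (2 ^ j)⁻¹ := by
    field_simp
    ring
  have h4 : (4 * (n : ℝ)) ^ 2 = 4 * n ^ 2 * 4 := by ring
  rw [h3, h4]
  gcongr
  exact Real.pi_le_four
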